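/- arXiv:2008.07003 — 5 statements merged into one kernel-verified Lean document; each statement's English description precedes it below -/
import Mathlib

section
/- The probabilists' Hermite polynomials h_n satisfy |h_n(s)| ≤ √(n!)·e^{s²/4} for all real s and all natural numbers n. -/
open Polynomial Filter Topology Set

theorem Polynomial.derivative_hermite_succ (n : ℕ) :
    derivative (hermite (n + 1)) = (n + 1 : ℤ[X]) * hermite n := by
  induction n with
  | zero => simp
  | succ n ih =>
    have h : derivative (hermite n) = X * hermite n - hermite (n + 1) := by
      rw [hermite_succ]; ring
    rw [hermite_succ (n + 1), derivative_sub, derivative_mul, derivative_X, ih, derivative_mul, h]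
    simp only [derivative_add, derivative_natCast, derivative_one]
    push_cast
    ring

/-- The Hermite function `h_n(s) e^{-s²/4}`, without its normalizing factor. -/
noncomputable def hermiteFun (n : ℕ) (s : ℝ) : ℝ :=
  aeval s (hermite n) * Real.exp (-(s ^ 2 / 4))

theorem hermiteFun_add_two (n : ℕ) (s : ℝ) :
    hermiteFun (n + 2) s = s * hermiteFun (n + 1) s - (n + 1) * hermiteFun n s := by
  simp only [hermiteFun]
  rw [hermite_succ (n + 1), derivative_hermite_succ]
  simp only [map_sub, map_mul, map_add, aeval_X, map_natCast, map_one]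
  ring

theorem hasDerivAt_hermiteFun (n : ℕ) (s : ℝ) :
    HasDerivAt (hermiteFun n) (s / 2 * hermiteFun n s - hermiteFun (n + 1) s) s := by
  have h1 := (hermite n).hasDerivAt_aeval s
  have h2 : HasDerivAt (fun s : ℝ => Real.exp (-(s ^ 2 / 4)))
      (Real.exp (-(s ^ 2 / 4)) * (-(2 * s / 4))) s := by
    simpa using (((hasDerivAt_pow 2 s).div_const 4).neg).exp
  refine (h1.mul h2).congr_deriv ?_
  simp only [hermiteFun, hermite_succ n, map_sub, map_mul, aeval_X]
  ring

theorem hasDerivAt_hermiteFun_succ (n : ℕ) (s : ℝ) :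
    HasDerivAt (hermiteFun (n + 1)) ((n + 1) * hermiteFun n s - s / 2 * hermiteFun (n + 1) s) s := by
  refine (hasDerivAt_hermiteFun (n + 1) s).congr_deriv ?_
  rw [hermiteFun_add_two]
  ring

theorem continuous_hermiteFun (n : ℕ) : Continuous (hermiteFun n) :=
  continuous_iff_continuousAt.2 fun s => (hasDerivAt_hermiteFun n s).continuousAt

theorem hermiteFun_zero (s : ℝ) : hermiteFun 0 s = Real.exp (-(s ^ 2 / 4)) := by
  simp [hermiteFun]

theorem hermiteFun_one (s : ℝ) : hermiteFun 1 s = s * Real.exp (-(s ^ 2 / 4)) := by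
  simp [hermiteFun]

theorem hermiteFun_neg (n : ℕ) (s : ℝ) : hermiteFun n (-s) = (-1) ^ n * hermiteFun n s := by
  induction n using Nat.twoStepInduction with
  | zero => simp [hermiteFun_zero]
  | one => simp [hermiteFun_one]
  | more n ih1 ih2 =>
    rw [hermiteFun_add_two, hermiteFun_add_two, ih1, ih2]
    ring

theorem hermiteFun_mul_hermiteFun_succ_zero (n : ℕ) :
    hermiteFun n 0 * hermiteFun (n + 1) 0 = 0 := by
  induction n with
  | zero => simp [hermiteFun_one]
  | succ n ih =>
    rw [hermiteFun_add_two]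
    linear_combination (-(n + 1 : ℝ)) * ih

theorem tendsto_hermiteFun_cocompact (n : ℕ) :
    Tendsto (hermiteFun n) (cocompact ℝ) (𝓝 0) := by
  suffices h : ∀ p : ℤ[X], Tendsto (fun s : ℝ => aeval s p * Real.exp (-(s ^ 2 / 4)))
      (cocompact ℝ) (𝓝 0) from h _
  intro p
  induction p using Polynomial.induction_on' with
  | add p q hp hq => simpa [add_mul] using hp.add hq
  | monomial k a =>
    have h := (tendsto_rpow_abs_mul_exp_neg_mul_sq_cocompact (a := 1 / 4) (by norm_num) k).const_mul
      |(a : ℝ)|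
    rw [mul_zero] at h
    refine squeeze_zero_norm (fun s => le_of_eq ?_) h
    rw [aeval_monomial, Real.rpow_natCast]
    simp only [norm_mul, Real.norm_eq_abs, abs_pow, Real.abs_exp, algebraMap_int_eq, eq_intCast]
    rw [mul_assoc]
    ring_nf

theorem exists_nonneg_forall_sq_hermiteFun_le (n : ℕ) :
    ∃ b, 0 ≤ b ∧ ∀ s, hermiteFun n s ^ 2 ≤ hermiteFun n b ^ 2 := by
  obtain ⟨b, hb⟩ : ∃ b, ∀ s, hermiteFun n s ^ 2 ≤ hermiteFun n b ^ 2 := by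
    by_cases h0 : ∀ s, hermiteFun n s = 0
    · exact ⟨0, by simp [h0]⟩
    push Not at h0
    obtain ⟨c, hc⟩ := h0
    refine ((continuous_hermiteFun n).pow 2).exists_forall_ge' c ?_
    have h := (tendsto_hermiteFun_cocompact n).pow 2
    rw [zero_pow two_ne_zero] at h
    exact (h.eventually_lt_const (by positivity : 0 < hermiteFun n c ^ 2)).mono fun _ => le_of_lt
  refine ⟨|b|, abs_nonneg b, fun s => (hb s).trans_eq ?_⟩
  rcases abs_choice b with h | h <;> rw [h]
  rw [hermiteFun_neg, mul_pow, ← pow_mul, mul_comm n, pow_mul]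
  simp

/-- A Sonin-type energy that equals `u² / (4(n + 1))` at the critical points of
`u = hermiteFun (n + 1)` and `v² / 4` at those of `v = hermiteFun n`. -/
noncomputable def hermiteEnergy (n : ℕ) (s : ℝ) : ℝ :=
  (hermiteFun (n + 1) s ^ 2 + (n + 1) * hermiteFun n s ^ 2
    - s * hermiteFun (n + 1) s * hermiteFun n s) / (4 * (n + 1) - s ^ 2)

theorem hasDerivAt_hermiteEnergy {n : ℕ} {s : ℝ} (hs : s ^ 2 < 4 * (n + 1)) :
    HasDerivAt (hermiteEnergy n)
      (4 * (((n + 1) * hermiteFun n s - s / 2 * hermiteFun (n + 1) s) *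
        (s / 2 * hermiteFun n s - hermiteFun (n + 1) s)) / (4 * (n + 1) - s ^ 2) ^ 2) s := by
  have hu := hasDerivAt_hermiteFun_succ n s
  have hv := hasDerivAt_hermiteFun n s
  have hne : 4 * ((n : ℝ) + 1) - s ^ 2 ≠ 0 := by linarith
  have h := (((hu.pow 2).add ((hv.pow 2).const_mul (n + 1 : ℝ))).sub
    (((hasDerivAt_id s).mul hu).mul hv)).div
    ((hasDerivAt_pow 2 s).const_sub (4 * ((n : ℝ) + 1))) hne
  refine h.congr_deriv ?_
  congr 1
  simp
  ring

theorem hermiteEnergy_of_deriv_succ_eq_zero {n : ℕ} {s : ℝ} (hs : s ^ 2 < 4 * (n + 1))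
    (h : (n + 1) * hermiteFun n s - s / 2 * hermiteFun (n + 1) s = 0) :
    hermiteEnergy n s = hermiteFun (n + 1) s ^ 2 / (4 * (n + 1)) := by
  have hne : 4 * ((n : ℝ) + 1) - s ^ 2 ≠ 0 := by linarith
  have hn : (n : ℝ) + 1 ≠ 0 := by positivity
  rw [hermiteEnergy, div_eq_div_iff hne (by positivity)]
  linear_combination (4 * (n + 1) * hermiteFun n s - 2 * s * hermiteFun (n + 1) s) * h

theorem hermiteEnergy_of_deriv_eq_zero {n : ℕ} {s : ℝ} (hs : s ^ 2 < 4 * (n + 1))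
    (h : s / 2 * hermiteFun n s - hermiteFun (n + 1) s = 0) :
    hermiteEnergy n s = hermiteFun n s ^ 2 / 4 := by
  have hne : 4 * ((n : ℝ) + 1) - s ^ 2 ≠ 0 := by linarith
  rw [hermiteEnergy, div_eq_div_iff hne (by norm_num)]
  linear_combination (2 * s * hermiteFun n s - 4 * hermiteFun (n + 1) s) * h

/-- The energy has a strict local minimum at a positive critical point of `hermiteFun (n + 1)`. -/
theorem exists_hermiteEnergy_lt {n : ℕ} {b : ℝ} (hb0 : 0 < b) (hb : b ^ 2 < 4 * (n + 1))
    (hcrit : (n + 1) * hermiteFun n b - b / 2 * hermiteFun (n + 1) b = 0)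
    (hu : hermiteFun (n + 1) b ≠ 0) :
    ∃ y ∈ Ico 0 b, hermiteEnergy n b < hermiteEnergy n y := by
  set g : ℝ → ℝ := fun s => ((n + 1) * hermiteFun n s - s / 2 * hermiteFun (n + 1) s) *
    (s / 2 * hermiteFun n s - hermiteFun (n + 1) s) with hg
  have hgb : g b = 0 := by simp [hg, hcrit]
  have hn : (0 : ℝ) < n + 1 := by positivity
  have hderiv : HasDerivAt g ((n + 1 + 1 / 2 - b ^ 2 / 4) * (n + 1 - b ^ 2 / 4) / (n + 1) *
      hermiteFun (n + 1) b ^ 2) b := by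
    have hu' := hasDerivAt_hermiteFun_succ n b
    have hv' := hasDerivAt_hermiteFun n b
    have hid := (hasDerivAt_id b).div_const 2
    refine (((hv'.const_mul (n + 1 : ℝ)).sub (hid.mul hu')).mul
      ((hid.mul hv').sub hu')).congr_deriv ?_
    have hv : hermiteFun n b = b / 2 * hermiteFun (n + 1) b / (n + 1) := by
      field_simp; linarith
    simp only [id, Pi.mul_apply, Pi.sub_apply]
    rw [hv]
    field_simp
    ring
  have hpos : 0 < (n + 1 + 1 / 2 - b ^ 2 / 4) * (n + 1 - b ^ 2 / 4) / (n + 1) *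
      hermiteFun (n + 1) b ^ 2 := by
    have h1 : 0 < (n : ℝ) + 1 + 1 / 2 - b ^ 2 / 4 := by linarith
    have h2 : 0 < (n : ℝ) + 1 - b ^ 2 / 4 := by linarith
    positivity
  have hneg : ∀ᶠ s in 𝓝[<] b, g s < 0 := by
    have h := (hasDerivAt_iff_tendsto_slope.1 hderiv).eventually_const_lt hpos
    have h' := h.filter_mono (nhdsWithin_mono b (fun x (hx : x < b) => hx.ne))
    filter_upwards [h', self_mem_nhdsWithin] with s hs (hsb : s < b)
    rw [slope_def_field, hgb, sub_zero] at hs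
    by_contra! hgs
    exact hs.not_ge (div_nonpos_of_nonneg_of_nonpos hgs (by linarith))
  obtain ⟨l, hl, hls⟩ := (mem_nhdsLT_iff_exists_Ioo_subset).1 hneg
  have hlt : max l 0 < b := max_lt hl hb0
  refine ⟨max l 0, ⟨le_max_right _ _, hlt⟩, ?_⟩
  have hsq : ∀ s ∈ Icc (max l 0) b, s ^ 2 < 4 * ((n : ℝ) + 1) := fun s hs =>
    (pow_le_pow_left₀ ((le_max_right _ _).trans hs.1) hs.2 2).trans_lt hb
  obtain ⟨c, hc, hcE⟩ := exists_hasDerivAt_eq_slope (hermiteEnergy n) _ hlt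
    (fun s hs => (hasDerivAt_hermiteEnergy (hsq s hs)).continuousAt.continuousWithinAt)
    (fun s hs => hasDerivAt_hermiteEnergy (hsq s (Ioo_subset_Icc_self hs)))
  have hgc : g c < 0 := hls ⟨(le_max_left _ _).trans_lt hc.1, hc.2⟩
  have hden := hsq c (Ioo_subset_Icc_self hc)
  have hslope : (hermiteEnergy n b - hermiteEnergy n (max l 0)) / (b - max l 0) < 0 := by
    rw [← hcE]
    exact div_neg_of_neg_of_pos (mul_neg_of_pos_of_neg four_pos hgc) (pow_pos (by linarith) 2)
  rw [div_lt_iff₀ (by linarith)] at hslope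
  linarith

theorem sq_hermiteFun_succ_le_of_isMax {n : ℕ} {b M : ℝ} (hb0 : 0 < b)
    (hmax : ∀ s, hermiteFun (n + 1) s ^ 2 ≤ hermiteFun (n + 1) b ^ 2)
    (hM : ∀ s, hermiteFun n s ^ 2 ≤ M) :
    hermiteFun (n + 1) b ^ 2 ≤ (n + 1) * M := by
  have hn : (0 : ℝ) < n + 1 := by positivity
  have hM0 : 0 ≤ M := (sq_nonneg _).trans (hM 0)
  by_cases hu : hermiteFun (n + 1) b = 0
  · rw [hu, zero_pow two_ne_zero]; positivity
  have hcrit : (n + 1) * hermiteFun n b - b / 2 * hermiteFun (n + 1) b = 0 := by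
    have h := IsLocalMax.hasDerivAt_eq_zero (f := fun s => hermiteFun (n + 1) s ^ 2)
      (Eventually.of_forall hmax) ((hasDerivAt_hermiteFun_succ n b).pow 2)
    simpa [hu] using h
  by_cases hb : 4 * ((n : ℝ) + 1) ≤ b ^ 2
  · have h1 : (n + 1) * hermiteFun (n + 1) b ^ 2 ≤ (n + 1) * ((n + 1) * hermiteFun n b ^ 2) := by
      have h2 : ((n + 1) * hermiteFun n b) ^ 2 = b ^ 2 / 4 * hermiteFun (n + 1) b ^ 2 := by
        rw [sub_eq_zero.1 hcrit]; ring
      nlinarith [sq_nonneg (hermiteFun (n + 1) b)]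
    exact (le_of_mul_le_mul_left h1 hn).trans (by gcongr; exact hM b)
  push Not at hb
  have hsq : ∀ s ∈ Icc 0 b, s ^ 2 < 4 * ((n : ℝ) + 1) := fun s hs =>
    (pow_le_pow_left₀ hs.1 hs.2 2).trans_lt hb
  obtain ⟨x, hx, hxmax⟩ := isCompact_Icc.exists_isMaxOn (nonempty_Icc.2 hb0.le)
    (fun s hs => (hasDerivAt_hermiteEnergy (hsq s hs)).continuousAt.continuousWithinAt)
  obtain ⟨y, hy, hby⟩ := exists_hermiteEnergy_lt hb0 hb hcrit hu
  have hbx : hermiteEnergy n b < hermiteEnergy n x := hby.trans_le (hxmax (Ico_subset_Icc_self hy))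
  have hEb := hermiteEnergy_of_deriv_succ_eq_zero hb hcrit
  have hprod : ((n + 1) * hermiteFun n x - x / 2 * hermiteFun (n + 1) x) *
      (x / 2 * hermiteFun n x - hermiteFun (n + 1) x) = 0 := by
    rcases hx.1.eq_or_lt with rfl | hx0
    · linear_combination (-(n + 1 : ℝ)) * hermiteFun_mul_hermiteFun_succ_zero n
    have hxb : x < b := hx.2.lt_of_ne (by rintro rfl; exact lt_irrefl _ hbx)
    have h := (hxmax.isLocalMax (Icc_mem_nhds hx0 hxb)).hasDerivAt_eq_zero
      (hasDerivAt_hermiteEnergy (hsq x hx))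
    have hne : 4 * ((n : ℝ) + 1) - x ^ 2 ≠ 0 := by linarith [hsq x hx]
    simpa only [div_eq_zero_iff, mul_eq_zero (a := (4 : ℝ)), OfNat.ofNat_ne_zero, false_or,
      pow_eq_zero_iff two_ne_zero, hne, or_false] using h
  rcases mul_eq_zero.1 hprod with h | h
  · rw [hEb, hermiteEnergy_of_deriv_succ_eq_zero (hsq x hx) h] at hbx
    exact absurd (hmax x) (not_le.2 ((div_lt_div_iff_of_pos_right (by positivity)).1 hbx))
  · rw [hEb, hermiteEnergy_of_deriv_eq_zero (hsq x hx) h, div_lt_div_iff₀ (by positivity)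
      (by norm_num)] at hbx
    nlinarith [hM x]

theorem sq_hermiteFun_zero_le (n : ℕ) : hermiteFun n 0 ^ 2 ≤ n.factorial := by
  induction n using Nat.twoStepInduction with
  | zero => simp [hermiteFun_zero]
  | one => simp [hermiteFun_one]
  | more n ih _ =>
    rw [hermiteFun_add_two, Nat.factorial_succ, Nat.factorial_succ]
    push_cast
    have hn : (0 : ℝ) ≤ n := n.cast_nonneg
    calc (0 * hermiteFun (n + 1) 0 - (n + 1) * hermiteFun n 0) ^ 2
        = ((n : ℝ) + 1) * ((n + 1) * hermiteFun n 0 ^ 2) := by ring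
      _ ≤ ((n : ℝ) + 1 + 1) * ((n + 1) * n.factorial) := by gcongr; linarith

theorem sq_hermiteFun_le (n : ℕ) (s : ℝ) : hermiteFun n s ^ 2 ≤ n.factorial := by
  induction n generalizing s with
  | zero =>
    rw [hermiteFun_zero, Nat.factorial_zero, Nat.cast_one]
    exact pow_le_one₀ (Real.exp_pos _).le (Real.exp_le_one_iff.2 (by nlinarith [sq_nonneg s]))
  | succ n ih =>
    obtain ⟨b, hb0, hmax⟩ := exists_nonneg_forall_sq_hermiteFun_le (n + 1)
    refine (hmax s).trans ?_
    rcases hb0.eq_or_lt with rfl | hb0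
    · exact sq_hermiteFun_zero_le _
    · rw [Nat.factorial_succ]
      exact_mod_cast sq_hermiteFun_succ_le_of_isMax hb0 hmax ih

theorem stmt3 (n : ℕ) (s : ℝ) :
    |Polynomial.aeval s (Polynomial.hermite n)| ≤
      Real.sqrt (Nat.factorial n) * Real.exp (s ^ 2 / 4) := by
  have h := Real.abs_le_sqrt (sq_hermiteFun_le n s)
  rwa [hermiteFun, abs_mul, Real.abs_exp, Real.exp_neg, ← div_eq_mul_inv,
    div_le_iff₀ (Real.exp_pos _)] at h
end

section
/- Gaussian integration by parts: if B, G_1, …, G_n are real-valued jointly Gaussian centered random variables and f: ℝⁿ → ℝ is a smooth function of moderate growth, then E[B·f(G_1,…,G_n)] = ∑_{i=1}^n E[B·G_i] · E[∂f/∂x_i (G_1,…,G_n)]. -/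
open MeasureTheory ProbabilityTheory

/-- **Stein's lemma** for a centered Gaussian measure on the real line. -/
theorem integral_id_mul_gaussianReal_zero {v : NNReal} {g g' : ℝ → ℝ}
    (hg : ∀ x, HasDerivAt g (g' x) x) (hg_int : Integrable g (gaussianReal 0 v))
    (hxg_int : Integrable (fun x => x * g x) (gaussianReal 0 v))
    (hg'_int : Integrable g' (gaussianReal 0 v)) :
    ∫ x, x * g x ∂gaussianReal 0 v = v * ∫ x, g' x ∂gaussianReal 0 v := by
  rcases eq_or_ne v 0 with rfl | hv
  · simp
  have hv' : (v : ℝ) ≠ 0 := by exact_mod_cast hv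
  have h_int (h : ℝ → ℝ) (hh : Integrable h (gaussianReal 0 v)) :
      Integrable (fun x => h x * gaussianPDFReal 0 v x) := by
    rw [gaussianReal_of_var_ne_zero _ hv, integrable_withDensity_iff
      (measurable_gaussianPDF _ _) (by simp [gaussianPDF])] at hh
    simpa using hh
  have hpdf (x : ℝ) : HasDerivAt (fun x => v * gaussianPDFReal 0 v x)
      (-(x * gaussianPDFReal 0 v x)) x := by
    have h1 : HasDerivAt (fun x : ℝ => -(x - 0) ^ 2 / (2 * v)) (-(x / v)) x := by
      refine ((((hasDerivAt_id x).sub_const 0).pow 2).neg.div_const (2 * (v : ℝ))).congr_deriv ?_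
      simp
      field_simp
    refine ((h1.exp.const_mul (√(2 * Real.pi * v))⁻¹).const_mul (v : ℝ)).congr_deriv ?_
    rw [gaussianPDFReal]
    field_simp
  have key := integral_mul_deriv_eq_deriv_mul_of_integrable
    (u := g) (v := fun x => v * gaussianPDFReal 0 v x) (u' := g')
    (v' := fun x => -(x * gaussianPDFReal 0 v x))
    (fun x _ => hg x) (fun x _ => hpdf x)
    (((h_int _ hxg_int).neg).congr (.of_forall fun x => by simp; ring))
    (((h_int _ hg'_int).const_mul (v : ℝ)).congr (.of_forall fun x => by simp; ring))
    (((h_int _ hg_int).const_mul (v : ℝ)).congr (.of_forall fun x => by simp; ring))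
  rw [integral_gaussianReal_eq_integral_smul hv, integral_gaussianReal_eq_integral_smul hv,
    ← integral_const_mul, ← neg_inj]
  simp only [smul_eq_mul]
  rw [← integral_neg]
  convert key using 1
  · congr with x; ring
  · congr 2 with x; ring

/-- A continuous function growing more slowly than every Gaussian weight is square integrable
when evaluated at a Gaussian vector. -/
theorem ProbabilityTheory.HasGaussianLaw.memLp_two_comp {Ω E F : Type*} {mΩ : MeasurableSpace Ω}
    {P : Measure Ω} [NormedAddCommGroup E] [NormedSpace ℝ E] [FiniteDimensional ℝ E]
    [MeasurableSpace E] [BorelSpace E] [NormedAddCommGroup F] {X : Ω → E}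
    (hX : HasGaussianLaw X P) {h : E → F} (hcont : Continuous h)
    (hgrowth : ∀ a : ℝ, 0 < a →
      Filter.Tendsto (fun x : E => ‖h x‖ * Real.exp (-a * ‖x‖ ^ 2))
        (Filter.cocompact _) (nhds 0)) :
    MemLp (fun ω => h (X ω)) 2 P := by
  have : CompleteSpace E := FiniteDimensional.complete ℝ E
  have : SecondCountableTopology E :=
    (ContinuousLinearEquiv.ofFinrankEq (𝕜 := ℝ) (E := E)
      (F := Fin (Module.finrank ℝ E) → ℝ) (by simp)).toHomeomorph.secondCountableTopology
  have := hX.isGaussian_map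
  obtain ⟨C, hC, hC_int⟩ := IsGaussian.exists_integrable_exp_sq (P.map X)
  obtain ⟨K, hK⟩ := (ZeroAtInftyContinuousMap.isBounded_range
    ⟨⟨fun x : E => ‖h x‖ * Real.exp (-(C / 2) * ‖x‖ ^ 2), by fun_prop⟩,
      hgrowth (C / 2) (by positivity)⟩).exists_norm_le
  have hbound (x : E) : ‖h x‖ ≤ K * Real.exp (C / 2 * ‖x‖ ^ 2) := by
    have : ‖h x‖ * Real.exp (-(C / 2) * ‖x‖ ^ 2) ≤ K :=
      (Real.le_norm_self _).trans (hK _ ⟨x, rfl⟩)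
    rwa [neg_mul, Real.exp_neg, ← div_eq_mul_inv, div_le_iff₀ (Real.exp_pos _)] at this
  suffices MemLp h 2 (P.map X) from
    (memLp_map_measure_iff (by fun_prop) hX.aemeasurable).1 this
  have hexp : MemLp (fun x : E => Real.exp (C / 2 * ‖x‖ ^ 2)) 2 (P.map X) := by
    rw [memLp_two_iff_integrable_sq (by fun_prop)]
    refine hC_int.congr (.of_forall fun x => ?_)
    simp only [← Real.exp_nat_mul]
    congr 1
    push_cast
    ring
  exact (hexp.const_mul K).mono (by fun_prop)
    (.of_forall fun x => (hbound x).trans (Real.le_norm_self _))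

/-- Gaussian integration by parts in the first of two independent variables. -/
theorem ProbabilityTheory.IndepFun.integral_mul_eq_of_gaussianReal {Ω F : Type*}
    {mΩ : MeasurableSpace Ω} {P : Measure Ω} [IsProbabilityMeasure P] [MeasurableSpace F]
    {B : Ω → ℝ} {Y : Ω → F} {v : NNReal} (hBY : IndepFun B Y P) (hB : AEMeasurable B P)
    (hY : AEMeasurable Y P) (hB_law : P.map B = gaussianReal 0 v)
    {g g' : ℝ × F → ℝ} (hg_meas : Measurable g) (hg'_meas : Measurable g')
    (hg : ∀ b y, HasDerivAt (fun b => g (b, y)) (g' (b, y)) b)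
    (hg_int : Integrable (fun ω => g (B ω, Y ω)) P)
    (hBg_int : Integrable (fun ω => B ω * g (B ω, Y ω)) P)
    (hg'_int : Integrable (fun ω => g' (B ω, Y ω)) P) :
    ∫ ω, B ω * g (B ω, Y ω) ∂P = v * ∫ ω, g' (B ω, Y ω) ∂P := by
  have hlaw : P.map (fun ω => (B ω, Y ω)) = (gaussianReal 0 v).prod (P.map Y) := by
    rw [(indepFun_iff_map_prod_eq_prod_map_map hB hY).1 hBY, hB_law]
  have hBY_meas : AEMeasurable (fun ω => (B ω, Y ω)) P := hB.prodMk hY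
  have : IsProbabilityMeasure (P.map Y) := Measure.isProbabilityMeasure_map hY
  have h_int (h : ℝ × F → ℝ) (hh : Measurable h) (hi : Integrable (fun ω => h (B ω, Y ω)) P) :
      Integrable h ((gaussianReal 0 v).prod (P.map Y)) := by
    rw [← hlaw]
    exact (integrable_map_measure hh.aestronglyMeasurable hBY_meas).2 hi
  have h_eq (h : ℝ × F → ℝ) (hh : Measurable h) (hi : Integrable (fun ω => h (B ω, Y ω)) P) :
      ∫ ω, h (B ω, Y ω) ∂P = ∫ y, ∫ b, h (b, y) ∂gaussianReal 0 v ∂P.map Y := by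
    rw [← integral_prod_symm _ (h_int h hh hi), ← hlaw,
      integral_map hBY_meas hh.aestronglyMeasurable]
  have hBg_meas : Measurable (fun p : ℝ × F => p.1 * g p) := by fun_prop
  rw [h_eq (fun p => p.1 * g p) hBg_meas hBg_int, h_eq g' hg'_meas hg'_int, ← integral_const_mul]
  refine integral_congr_ae ?_
  filter_upwards [(h_int g hg_meas hg_int).prod_left_ae,
    (h_int (fun p => p.1 * g p) hBg_meas hBg_int).prod_left_ae,
    (h_int g' hg'_meas hg'_int).prod_left_ae] with y h1 h2 h3
  exact integral_id_mul_gaussianReal_zero (fun b => hg b y) h1 h2 h3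

/-- Random variables all of whose linear combinations are centered Gaussian are jointly Gaussian. -/
theorem hasGaussianLaw_prodMk_of_forall_linear_combination {Ω ι : Type*} [Fintype ι]
    {mΩ : MeasurableSpace Ω} {P : Measure Ω} {B : Ω → ℝ} {X : ι → Ω → ℝ}
    (hB : AEMeasurable B P) (hX : ∀ i, AEMeasurable (X i) P)
    (h : ∀ (c : ℝ) (d : ι → ℝ), ∃ v : NNReal,
      P.map (fun ω => c * B ω + ∑ i, d i * X i ω) = gaussianReal 0 v) :
    HasGaussianLaw (fun ω => (B ω, fun i => X i ω)) P where
  isGaussian_map := by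
    classical
    refine isGaussian_of_map_eq_gaussianReal fun L => ⟨0, ?_⟩
    obtain ⟨v, hv⟩ := h (L (1, 0)) fun i => L (0, Pi.single i 1)
    refine ⟨v, ?_⟩
    rw [AEMeasurable.map_map_of_aemeasurable (by fun_prop) (by fun_prop), ← hv]
    congr 1 with ω
    have hsplit : ((B ω, fun i => X i ω) : ℝ × (ι → ℝ)) =
        B ω • (1, 0) + ∑ i, X i ω • (0, Pi.single i 1) := by
      ext j
      · simp [Prod.fst_sum]
      · simp [Prod.snd_sum, Finset.sum_apply, Pi.single_apply]
    simp only [Function.comp_apply]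
    rw [hsplit, map_add, map_sum]
    simp only [map_smul, smul_eq_mul, mul_comm]

theorem stmt8 {Ω : Type*} [MeasureSpace Ω] [IsProbabilityMeasure (ℙ : Measure Ω)]
    {n : ℕ} (B : Ω → ℝ) (X : Fin n → Ω → ℝ)
    (hGauss : ∀ (c : ℝ) (d : Fin n → ℝ), ∃ v : NNReal,
      Measure.map (fun ω => c * B ω + ∑ i, d i * X i ω) ℙ = gaussianReal 0 v)
    (f : (Fin n → ℝ) → ℝ) (hf : ContDiff ℝ (⊤ : ℕ∞) f)
    (hgrowth : ∀ (m : ℕ) (a : ℝ), 0 < a →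
      Filter.Tendsto (fun x : Fin n → ℝ => ‖iteratedFDeriv ℝ m f x‖ * Real.exp (-a * ‖x‖ ^ 2))
        (Filter.cocompact _) (nhds 0)) :
    ∫ ω, B ω * f (fun i => X i ω) =
      ∑ i, (∫ ω, B ω * X i ω) * ∫ ω, fderiv ℝ f (fun j => X j ω) (Pi.single i 1) := by
  have h_aemeas {Z : Ω → ℝ} {v : NNReal} (hZ : Measure.map Z ℙ = gaussianReal 0 v) :
      AEMeasurable Z ℙ :=
    AEMeasurable.of_map_ne_zero (by rw [hZ]; exact IsProbabilityMeasure.ne_zero _)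
  obtain ⟨v, hB_law⟩ : ∃ v : NNReal, Measure.map B ℙ = gaussianReal 0 v := by
    simpa using hGauss 1 0
  have hB : AEMeasurable B ℙ := h_aemeas hB_law
  have hX (i : Fin n) : AEMeasurable (X i) ℙ := by
    obtain ⟨u, hu⟩ := hGauss 0 (Pi.single i 1)
    exact h_aemeas (v := u) (by simpa [Pi.single_apply] using hu)
  have hBX := hasGaussianLaw_prodMk_of_forall_linear_combination hB hX hGauss
  have hB2 : MemLp B 2 ℙ := hBX.fst.memLp_two
  have hX2 (i : Fin n) : MemLp (X i) 2 ℙ := (hBX.snd.eval i).memLp_two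
  have hB_mean : ∫ ω, B ω = 0 := by
    rw [← integral_id_gaussianReal (μ := 0) (v := v), ← hB_law, integral_map hB (by fun_prop)]
  have hB_cov (Z : Ω → ℝ) (hZ : MemLp Z 2 ℙ) : cov[B, Z; ℙ] = ∫ ω, B ω * Z ω := by
    rw [covariance_eq_sub hB2 hZ, hB_mean]
    simp
  have hB_var : cov[B, B; ℙ] = v := by
    rw [covariance_self hB, ← variance_id_gaussianReal (μ := 0) (v := v), ← hB_law,
      variance_map (by fun_prop) hB]
    rfl
  obtain ⟨w, hw⟩ : ∃ w : Fin n → ℝ, ∀ i, ∫ ω, B ω * X i ω = v * w i := by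
    refine ⟨fun i => (∫ ω, B ω * X i ω) / v, fun i => ?_⟩
    rcases eq_or_ne v 0 with rfl | hv
    · have hB0 : B =ᵐ[ℙ] 0 := ae_of_ae_map hB (p := fun x => x = 0) (by simp [hB_law])
      have : ∫ ω, B ω * X i ω = 0 :=
        integral_eq_zero_of_ae (by filter_upwards [hB0] with ω hω; simp [hω])
      simp [this]
    · field_simp
  let Y : Ω → Fin n → ℝ := fun ω => (fun i => X i ω) - B ω • w
  have hBY : HasGaussianLaw (fun ω => (B ω, Y ω)) ℙ :=
    hBX.map_fun ((ContinuousLinearMap.fst ℝ ℝ (Fin n → ℝ)).prod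
      (ContinuousLinearMap.snd ℝ ℝ (Fin n → ℝ) -
        (ContinuousLinearMap.fst ℝ ℝ (Fin n → ℝ)).smulRight w))
  have hY2 (i : Fin n) : MemLp (fun ω => Y ω i) 2 ℙ := (hBY.snd.eval i).memLp_two
  have hBY_cov (i : Fin n) : cov[B, fun ω => Y ω i; ℙ] = 0 := by
    have : (fun ω => Y ω i) = fun ω => X i ω - B ω * w i := rfl
    rw [this, covariance_fun_sub_right hB2 (hX2 i) (hB2.mul_const _), covariance_mul_const_right,
      hB_var, hB_cov _ (hX2 i), hw, sub_self]
  have hBY_indep : IndepFun B Y ℙ := by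
    refine hBY.indepFun_of_covariance_strongDual fun L₁ L₂ => ?_
    have h1 : L₁ ∘ B = fun ω => B ω * L₁ 1 := by
      ext ω
      simpa using map_smul L₁ (B ω) 1
    have h2 : L₂ ∘ Y = fun ω => ∑ i, Y ω i * L₂ (Pi.single i 1) := by
      ext ω
      simp only [Function.comp_apply]
      conv_lhs => rw [pi_eq_sum_univ' (Y ω), map_sum]
      simp only [map_smul, smul_eq_mul]
    rw [h1, h2, covariance_mul_const_left,
      covariance_fun_sum_right (fun i => (hY2 i).mul_const _) hB2]
    simp [covariance_mul_const_right, hBY_cov]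
  have hf_diff : Differentiable ℝ f := hf.differentiable (by simp)
  have hf'_cont : Continuous (fderiv ℝ f) := hf.continuous_fderiv (by simp)
  have hfX : MemLp (fun ω => f (fun i => X i ω)) 2 ℙ :=
    hBX.snd.memLp_two_comp hf.continuous fun a ha => by simpa using hgrowth 0 a ha
  have hf'X : MemLp (fun ω => fderiv ℝ f (fun i => X i ω)) 2 ℙ :=
    hBX.snd.memLp_two_comp hf'_cont fun a ha => by
      simpa [norm_iteratedFDeriv_one] using hgrowth 1 a ha
  have hf'X_int (u : Fin n → ℝ) : Integrable (fun ω => fderiv ℝ f (fun i => X i ω) u) ℙ :=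
    (hf'X.integrable (by norm_num)).apply_continuousLinearMap u
  have hXY (ω : Ω) : B ω • w + Y ω = fun i => X i ω := by simp [Y]
  have key := hBY_indep.integral_mul_eq_of_gaussianReal hB hBY.snd.aemeasurable hB_law
    (g := fun p => f (p.1 • w + p.2)) (g' := fun p => fderiv ℝ f (p.1 • w + p.2) w)
    (by have := hf.continuous; fun_prop) (by fun_prop)
    (fun b y => by
      have h1 : HasDerivAt (fun b : ℝ => b • w + y) w b := by
        simpa using ((hasDerivAt_id b).smul_const w).add_const y
      exact (hf_diff _).hasFDerivAt.comp_hasDerivAt b h1)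
    (by simpa only [hXY] using hfX.integrable (by norm_num))
    (by simp only [hXY]; exact hB2.integrable_mul hfX)
    (by simpa only [hXY] using hf'X_int w)
  simp only [hXY] at key
  have hw_sum (x : Fin n → ℝ) :
      fderiv ℝ f x w = ∑ i, w i * fderiv ℝ f x (Pi.single i 1) := by
    conv_lhs => rw [pi_eq_sum_univ' w, map_sum]
    simp only [map_smul, smul_eq_mul]
  rw [key]
  simp only [hw_sum, hw]
  rw [integral_finsetSum _ fun i _ => (hf'X_int _).const_mul _, Finset.mul_sum]
  simp only [integral_const_mul, mul_assoc]
end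

section
/- Gaussian interpolation formula: let G, B be independent centered Gaussian vectors in ℝⁿ and f: ℝⁿ → ℝ a smooth function of moderate growth. Define G(t) = √t·G + √(1−t)·B and ζ(t) = E[f(G(t))]. Then for 0 < t < 1, ζ'(t) = (1/2)·∑_{i,j} (E[G_iG_j] − E[B_iB_j]) · E[∂²f/∂x_i∂x_j (G(t))]. -/
open MeasureTheory ProbabilityTheory

section ModerateGrowth

variable {D E F : Type*} [NormedAddCommGroup D] [NormedAddCommGroup E] [NormedAddCommGroup F]

/-- A function has moderate growth if it is dominated by a multiple of every Gaussian
`x ↦ exp (a * ‖x‖ ^ 2)`, `a > 0`. -/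
def ModerateGrowth (f : E → F) : Prop :=
  ∀ a : ℝ, 0 < a → ∃ C, ∀ x, ‖f x‖ ≤ C * Real.exp (a * ‖x‖ ^ 2)

namespace ModerateGrowth

lemma of_norm_le {G : Type*} [NormedAddCommGroup G] {f : E → F} {g : E → G}
    (hg : ModerateGrowth g) {K : ℝ} (hK : 0 ≤ K) (h : ∀ x, ‖f x‖ ≤ K * ‖g x‖) :
    ModerateGrowth f := fun a ha ↦ by
  obtain ⟨C, hC⟩ := hg a ha
  refine ⟨K * C, fun x ↦ (h x).trans ?_⟩
  rw [mul_assoc]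
  exact mul_le_mul_of_nonneg_left (hC x) hK

lemma mul {f g : E → ℝ} (hf : ModerateGrowth f) (hg : ModerateGrowth g) :
    ModerateGrowth (fun x ↦ f x * g x) := fun a ha ↦ by
  obtain ⟨C, hC⟩ := hf (a / 2) (half_pos ha)
  obtain ⟨C', hC'⟩ := hg (a / 2) (half_pos ha)
  refine ⟨C * C', fun x ↦ ?_⟩
  rw [norm_mul]
  refine (mul_le_mul (hC x) (hC' x) (norm_nonneg _) ((norm_nonneg _).trans (hC x))).trans_eq ?_
  rw [mul_mul_mul_comm, ← Real.exp_add]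
  ring_nf

lemma id : ModerateGrowth (fun x : E ↦ x) := fun a ha ↦ by
  refine ⟨1 + 1 / a, fun x ↦ ?_⟩
  have h1 : a * ‖x‖ ^ 2 + 1 ≤ Real.exp (a * ‖x‖ ^ 2) := Real.add_one_le_exp _
  have h2 : (1 + 1 / a) * (a * ‖x‖ ^ 2 + 1) = a * ‖x‖ ^ 2 + 1 + ‖x‖ ^ 2 + 1 / a := by
    field_simp
    ring
  calc ‖x‖ ≤ (1 + 1 / a) * (a * ‖x‖ ^ 2 + 1) := by
        rw [h2]
        have : 0 < 1 / a := by positivity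
        nlinarith [sq_nonneg (‖x‖ - 1), mul_nonneg ha.le (sq_nonneg ‖x‖)]
    _ ≤ _ := by gcongr

lemma clm [NormedSpace ℝ E] [NormedSpace ℝ F] (L : E →L[ℝ] F) : ModerateGrowth L :=
  id.of_norm_le (norm_nonneg L) L.le_opNorm

lemma comp {f : E → F} (hf : ModerateGrowth f) {u : D → E} {c d : ℝ}
    (hu : ∀ x, ‖u x‖ ≤ c + d * ‖x‖) : ModerateGrowth (fun x ↦ f (u x)) := fun a ha ↦ by
  have hd : 0 < 2 * (d ^ 2 + 1) := by positivity
  obtain ⟨C, hC⟩ := hf (a / (2 * (d ^ 2 + 1))) (by positivity)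
  have hC0 : 0 ≤ C := by
    have h := (norm_nonneg _).trans (hC 0)
    simpa using h
  refine ⟨C * Real.exp (a * c ^ 2), fun x ↦ (hC (u x)).trans ?_⟩
  rw [mul_assoc, ← Real.exp_add]
  gcongr
  rw [div_mul_eq_mul_div, div_le_iff₀ hd]
  have h1 : ‖u x‖ ^ 2 ≤ (c + d * ‖x‖) ^ 2 := by
    gcongr
    exact hu x
  have h2 : ‖u x‖ ^ 2 ≤ (c ^ 2 + ‖x‖ ^ 2) * (2 * (d ^ 2 + 1)) := by
    nlinarith [sq_nonneg (c - d * ‖x‖), sq_nonneg (c * d), sq_nonneg c, sq_nonneg ‖x‖]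
  nlinarith

lemma comp_clm [NormedSpace ℝ D] [NormedSpace ℝ E] {f : E → F} (hf : ModerateGrowth f)
    (A : D →L[ℝ] E) : ModerateGrowth (fun x ↦ f (A x)) :=
  hf.comp (c := 0) (d := ‖A‖) fun x ↦ by simpa using A.le_opNorm x

lemma of_tendsto [ProperSpace E] {f : E → F} (hf : Continuous f)
    (h : ∀ a : ℝ, 0 < a → Filter.Tendsto (fun x ↦ ‖f x‖ * Real.exp (-a * ‖x‖ ^ 2))
      (Filter.cocompact E) (nhds 0)) : ModerateGrowth f := fun a ha ↦ by
  have hcont : Continuous fun x ↦ ‖f x‖ * Real.exp (-a * ‖x‖ ^ 2) := by fun_prop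
  obtain ⟨K, hK, hKs⟩ := Filter.mem_cocompact.1 ((h a ha).eventually_le_const one_pos)
  obtain ⟨C, hC⟩ := hK.exists_bound_of_continuousOn hcont.continuousOn
  refine ⟨max C 1, fun x ↦ ?_⟩
  have hx : ‖f x‖ * Real.exp (-a * ‖x‖ ^ 2) ≤ max C 1 := by
    by_cases hxK : x ∈ K
    · exact ((le_abs_self _).trans (hC x hxK)).trans (le_max_left _ _)
    · exact (hKs hxK).trans (le_max_right _ _)
  rwa [neg_mul, Real.exp_neg, ← div_eq_mul_inv, div_le_iff₀ (Real.exp_pos _)] at hx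

lemma integrable [NormedSpace ℝ E] [CompleteSpace E] [SecondCountableTopology E]
    [MeasurableSpace E] [BorelSpace E] {f : E → F} (hf : ModerateGrowth f) (hc : Continuous f)
    (μ : Measure E) [IsGaussian μ] : Integrable f μ := by
  obtain ⟨a, ha, hint⟩ := IsGaussian.exists_integrable_exp_sq μ
  obtain ⟨C, hC⟩ := hf a ha
  exact (hint.const_mul C).mono' hc.aestronglyMeasurable (.of_forall hC)

end ModerateGrowth

end ModerateGrowth

section Stein

lemma hasDerivAt_gaussianPDFReal (v : NNReal) (x : ℝ) :
    HasDerivAt (gaussianPDFReal 0 v) (-(x / v) * gaussianPDFReal 0 v x) x := by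
  have h : HasDerivAt (fun x : ℝ ↦ -(x - 0) ^ 2 / (2 * v)) (-(x / v)) x := by
    have := ((((hasDerivAt_id x).sub_const 0).pow 2).neg).div_const (2 * (v : ℝ))
    refine this.congr_deriv ?_
    by_cases hv : (v : ℝ) = 0
    · simp [hv]
    · simp
      field_simp
  rw [gaussianPDFReal_def]
  exact (h.exp.const_mul _).congr_deriv (by ring)

lemma integrable_gaussianReal_iff {m : ℝ} {v : NNReal} (hv : v ≠ 0) {f : ℝ → ℝ} :
    Integrable f (gaussianReal m v) ↔ Integrable (fun x ↦ gaussianPDFReal m v x * f x) := by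
  rw [gaussianReal_of_var_ne_zero _ hv,
    integrable_withDensity_iff_integrable_smul' (measurable_gaussianPDF _ _)
      (ae_of_all _ fun _ ↦ gaussianPDF_lt_top)]
  simp [toReal_gaussianPDF]

/-- **Stein's lemma** for a centered real Gaussian measure. -/
lemma integral_id_mul_gaussianReal {v : NNReal} (hv : v ≠ 0) {φ φ' : ℝ → ℝ}
    (hφ : ∀ x, HasDerivAt φ (φ' x) x) (h0 : Integrable φ (gaussianReal 0 v))
    (h1 : Integrable (fun x ↦ x * φ x) (gaussianReal 0 v))
    (h2 : Integrable φ' (gaussianReal 0 v)) :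
    ∫ x, x * φ x ∂gaussianReal 0 v = v * ∫ x, φ' x ∂gaussianReal 0 v := by
  have hv' : (v : ℝ) ≠ 0 := by exact_mod_cast hv
  rw [integrable_gaussianReal_iff hv] at h0 h1 h2
  have key := integral_mul_deriv_eq_deriv_mul_of_integrable (u := φ) (u' := φ')
    (v := gaussianPDFReal 0 v) (v' := fun x ↦ -(x / v) * gaussianPDFReal 0 v x)
    (fun x _ ↦ hφ x) (fun x _ ↦ hasDerivAt_gaussianPDFReal v x)
    ((h1.const_mul (-(v : ℝ)⁻¹)).congr (.of_forall fun x ↦ by simp; ring))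
    (h2.congr (.of_forall fun x ↦ by simp; ring)) (h0.congr (.of_forall fun x ↦ by simp; ring))
  rw [integral_gaussianReal_eq_integral_smul hv, integral_gaussianReal_eq_integral_smul hv]
  calc ∫ x, gaussianPDFReal 0 v x • (x * φ x)
      = -v * ∫ x, φ x * (-(x / v) * gaussianPDFReal 0 v x) := by
        rw [← integral_const_mul]
        congr with x
        simp
        field_simp
    _ = _ := by
        rw [key, neg_mul_neg]
        congr 2 with x
        simp [mul_comm]

variable {V : Type*} [NormedAddCommGroup V] [NormedSpace ℝ V] [CompleteSpace V]
  [SecondCountableTopology V] [MeasurableSpace V] [BorelSpace V]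

lemma integrable_dual_smul_self (μ : Measure V) [IsGaussian μ] (L : StrongDual ℝ V) :
    Integrable (fun q ↦ L q • q) μ := by
  have h : ModerateGrowth (fun q : V ↦ L q * ‖q‖) :=
    (ModerateGrowth.clm L).mul (ModerateGrowth.id.of_norm_le zero_le_one (by simp))
  exact (h.of_norm_le zero_le_one (by simp [norm_smul])).integrable (by fun_prop) μ

lemma indepFun_dual_sub_smul (μ : Measure V) [IsGaussian μ] (hμ : ∫ x, x ∂μ = 0)
    (L : StrongDual ℝ V) (hv : ∫ q, L q * L q ∂μ ≠ 0) :
    IndepFun L (ContinuousLinearMap.id ℝ V -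
      L.smulRight ((∫ q, L q * L q ∂μ)⁻¹ • ∫ q, L q • q ∂μ)) μ := by
  have hdual (L' : StrongDual ℝ V) : ∫ q, L' q ∂μ = 0 := by
    rw [IsGaussian.integral_dual, hμ, map_zero]
  have hL (L' : StrongDual ℝ V) : ∫ q, L q * L' q ∂μ = L' (∫ q, L q • q ∂μ) := by
    rw [← L'.integral_comp_comm (integrable_dual_smul_self μ L)]
    simp
  set W : V →L[ℝ] V := ContinuousLinearMap.id ℝ V -
      L.smulRight ((∫ q, L q * L q ∂μ)⁻¹ • ∫ q, L q • q ∂μ) with hW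
  refine HasGaussianLaw.indepFun_of_covariance_strongDual
    (IsGaussian.hasGaussianLaw_id.map_fun (L.prod W)) fun L₁ L₂ ↦ ?_
  have e₁ : (L₁ ∘ L : V → ℝ) = L₁.comp L := rfl
  have e₂ : (L₂ ∘ W : V → ℝ) = L₂.comp W := rfl
  rw [e₁, e₂, covariance_eq_sub (IsGaussian.memLp_dual μ _ 2 (by simp))
    (IsGaussian.memLp_dual μ _ 2 (by simp)), hdual, zero_mul, sub_zero]
  have e₃ (q : V) : (L₁.comp L q) * (L₂.comp W q) = L₁ 1 * (L q * (L₂.comp W) q) := by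
    rw [← mul_assoc]
    congr 1
    have := L₁.map_smul (L q) 1
    simpa [mul_comm] using this
  have hWh : W (∫ q, L q • q ∂μ) = 0 := by
    simp [hW, ← hL L, smul_inv_smul₀ hv]
  simp only [Pi.mul_apply, e₃]
  rw [integral_const_mul, hL, ContinuousLinearMap.comp_apply, hWh, map_zero, mul_zero]

/-- **Stein's lemma** (Gaussian integration by parts) for a centered Gaussian measure. -/
lemma integral_dual_mul_eq_integral_fderiv (μ : Measure V) [IsGaussian μ] (hμ : ∫ x, x ∂μ = 0)
    (L : StrongDual ℝ V) {g : V → ℝ} (hg : ContDiff ℝ 1 g) (hg0 : ModerateGrowth g)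
    (hg1 : ModerateGrowth (fderiv ℝ g)) :
    ∫ p, L p * g p ∂μ = ∫ p, fderiv ℝ g p (∫ q, L q • q ∂μ) ∂μ := by
  have hLL : Integrable (fun q ↦ L q * L q) μ :=
    ((ModerateGrowth.clm L).mul (ModerateGrowth.clm L)).integrable (by fun_prop) μ
  by_cases hv : ∫ q, L q * L q ∂μ = 0
  · rw [integral_eq_zero_iff_of_nonneg (fun q ↦ mul_self_nonneg _) hLL] at hv
    have hL0 : ∀ᵐ q ∂μ, L q = 0 := hv.mono fun q hq ↦ by simpa using hq
    rw [integral_eq_zero_of_ae (hL0.mono fun q hq ↦ by simp [hq]),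
      integral_eq_zero_of_ae (f := fun q ↦ L q • q) (hL0.mono fun q hq ↦ by simp [hq])]
    simp
  have hindep := indepFun_dual_sub_smul μ hμ L hv
  have hmap : μ.map L = gaussianReal 0 (∫ q, L q * L q ∂μ).toNNReal := by
    rw [IsGaussian.map_eq_gaussianReal L, IsGaussian.integral_dual, hμ, map_zero,
      variance_of_integral_eq_zero (by fun_prop)
        (by rw [IsGaussian.integral_dual, hμ, map_zero])]
    simp [sq]
  have hv0 : 0 ≤ ∫ q, L q * L q ∂μ := integral_nonneg fun q ↦ mul_self_nonneg _
  set v := ∫ q, L q * L q ∂μ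
  set h := ∫ q, L q • q ∂μ
  set W : V →L[ℝ] V := ContinuousLinearMap.id ℝ V - L.smulRight (v⁻¹ • h)
  set k : V := v⁻¹ • h
  let γ := gaussianReal 0 v.toNNReal
  let ν := μ.map W
  have hprod : μ.map (fun p ↦ (L p, W p)) = γ.prod ν := by
    rw [(indepFun_iff_map_prod_eq_prod_map_map (by fun_prop) (by fun_prop)).1 hindep, hmap]
  have hrec (p : V) : W p + L p • k = p := by simp [W, k]
  have htransfer {ψ : ℝ × V → ℝ} (hψ : Continuous ψ) :
      ∫ p, ψ (L p, W p) ∂μ = ∫ z, ψ z ∂(γ.prod ν) := by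
    rw [← hprod, integral_map (by fun_prop) hψ.aestronglyMeasurable]
  let Φ : ℝ × V →L[ℝ] V := ContinuousLinearMap.snd ℝ ℝ V +
    (ContinuousLinearMap.fst ℝ ℝ V).smulRight k
  have hΦ (x : ℝ) (w : V) : Φ (x, w) = w + x • k := rfl
  have hgc : Continuous g := hg.continuous
  have hgc' : Continuous (fderiv ℝ g) := hg.continuous_fderiv one_ne_zero
  have hdk : ModerateGrowth (fun p ↦ fderiv ℝ g p k) :=
    hg1.of_norm_le (norm_nonneg k) fun p ↦ by
      rw [mul_comm]
      exact (fderiv ℝ g p).le_opNorm k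
  have hline (w : V) (x : ℝ) : ‖w + x • k‖ ≤ ‖w‖ + ‖k‖ * ‖x‖ := by
    refine (norm_add_le _ _).trans ?_
    rw [norm_smul, mul_comm]
  have hvN : v.toNNReal ≠ 0 := by
    rw [Ne, Real.toNNReal_eq_zero, not_le]
    exact lt_of_le_of_ne hv0 (Ne.symm hv)
  calc ∫ p, L p * g p ∂μ = ∫ p, (fun z : ℝ × V ↦ z.1 * g (Φ z)) (L p, W p) ∂μ := by
        simp [hΦ, hrec]
    _ = ∫ z : ℝ × V, z.1 * g (Φ z) ∂(γ.prod ν) :=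
        htransfer (ψ := fun z ↦ z.1 * g (Φ z)) (by fun_prop)
    _ = ∫ w, ∫ x, x * g (w + x • k) ∂γ ∂ν :=
        integral_prod_symm (fun z : ℝ × V ↦ z.1 * g (Φ z)) (ModerateGrowth.integrable
          ((ModerateGrowth.clm (ContinuousLinearMap.fst ℝ ℝ V)).mul (hg0.comp_clm Φ))
          (by fun_prop) _)
    _ = ∫ w, ∫ x, v * fderiv ℝ g (w + x • k) k ∂γ ∂ν := by
        congr with w
        have hb := hg0.comp (hline w)
        rw [integral_id_mul_gaussianReal hvN (φ' := fun x ↦ fderiv ℝ g (w + x • k) k)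
          (fun x ↦ ?_) (hb.integrable (by fun_prop) _)
          ((ModerateGrowth.id.mul hb).integrable (by fun_prop) _)
          ((hdk.comp (hline w)).integrable (by fun_prop) _), integral_const_mul,
          Real.coe_toNNReal _ hv0]
        have h1 : HasDerivAt (fun x : ℝ ↦ w + x • k) k x := by
          simpa using ((hasDerivAt_id x).smul_const k).const_add w
        exact ((hg.differentiable one_ne_zero) _).hasFDerivAt.comp_hasDerivAt x h1
    _ = ∫ z : ℝ × V, v * fderiv ℝ g (Φ z) k ∂(γ.prod ν) :=
        (integral_prod_symm (fun z : ℝ × V ↦ v * fderiv ℝ g (Φ z) k)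
          (((hdk.comp_clm Φ).integrable (by fun_prop) _).const_mul v)).symm
    _ = ∫ p, (fun z : ℝ × V ↦ v * fderiv ℝ g (Φ z) k) (L p, W p) ∂μ :=
        (htransfer (ψ := fun z ↦ v * fderiv ℝ g (Φ z) k) (by fun_prop)).symm
    _ = ∫ p, fderiv ℝ g p h ∂μ := by
        congr with p
        simp only [hΦ, hrec]
        rw [← smul_eq_mul, ← map_smul, smul_inv_smul₀ hv]

end Stein

section Interpolation

/-- Multivariate Gaussian integration by parts, in coordinates. -/
lemma integral_fderiv_clm_eq_sum {V : Type*} [NormedAddCommGroup V] [NormedSpace ℝ V]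
    [CompleteSpace V] [SecondCountableTopology V] [MeasurableSpace V] [BorelSpace V]
    (μ : Measure V) [IsGaussian μ] (hμ : ∫ x, x ∂μ = 0) {ι : Type*} [Fintype ι] [DecidableEq ι]
    (A A' : V →L[ℝ] ι → ℝ) {f : (ι → ℝ) → ℝ} (hf : ContDiff ℝ 2 f)
    (hf1 : ModerateGrowth (fderiv ℝ f)) (hf2 : ModerateGrowth (fderiv ℝ (fderiv ℝ f))) :
    ∫ p, fderiv ℝ f (A p) (A' p) ∂μ = ∑ i, ∑ j, (∫ q, A' q i * A q j ∂μ) *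
      ∫ p, fderiv ℝ (fun y ↦ fderiv ℝ f y (Pi.single i 1)) (A p) (Pi.single j 1) ∂μ := by
  have hdf : ContDiff ℝ 1 (fderiv ℝ f) := hf.fderiv_right (by norm_num)
  have hddf : Continuous (fderiv ℝ (fderiv ℝ f)) := hdf.continuous_fderiv one_ne_zero
  have hflip (e y : ι → ℝ) : fderiv ℝ (fun y ↦ fderiv ℝ f y e) y =
      (fderiv ℝ (fderiv ℝ f) y).flip e := by
    rw [fderiv_clm_apply (hdf.differentiable one_ne_zero y) (by fun_prop)]
    simp
  let g (i : ι) (p : V) : ℝ := fderiv ℝ f (A p) (Pi.single i 1)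
  have hgc (i : ι) : ContDiff ℝ 1 (g i) :=
    (hdf.comp A.contDiff).clm_apply contDiff_const
  have hg0 (i : ι) : ModerateGrowth (g i) :=
    (hf1.comp_clm A).of_norm_le (norm_nonneg (Pi.single i 1)) fun p ↦ by
      rw [mul_comm]
      exact (fderiv ℝ f (A p)).le_opNorm _
  have hgd (i : ι) (p : V) : fderiv ℝ (g i) p =
      ((fderiv ℝ (fderiv ℝ f) (A p)).flip (Pi.single i 1)).comp A := by
    rw [← hflip]
    have h : DifferentiableAt ℝ (fun y ↦ fderiv ℝ f y (Pi.single i 1)) (A p) :=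
      (hdf.differentiable one_ne_zero _).clm_apply (by fun_prop)
    exact (h.hasFDerivAt.comp p A.hasFDerivAt).fderiv
  have hg1 (i : ι) : ModerateGrowth (fderiv ℝ (g i)) :=
    (hf2.comp_clm A).of_norm_le (K := ‖(Pi.single i 1 : ι → ℝ)‖ * ‖A‖) (by positivity)
      fun p ↦ by
        rw [hgd]
        calc _ ≤ ‖(fderiv ℝ (fderiv ℝ f) (A p)).flip (Pi.single i 1)‖ * ‖A‖ :=
              ContinuousLinearMap.opNorm_comp_le _ _
          _ ≤ (‖(fderiv ℝ (fderiv ℝ f) (A p)).flip‖ * ‖(Pi.single i 1 : ι → ℝ)‖) * ‖A‖ := by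
              gcongr
              exact ContinuousLinearMap.le_opNorm _ _
          _ = _ := by
              rw [ContinuousLinearMap.opNorm_flip]
              ring
  have hgcont (i : ι) : Continuous (g i) := (hgc i).continuous
  have hexp (T : (ι → ℝ) →L[ℝ] ℝ) (x : ι → ℝ) : T x = ∑ i, x i * T (Pi.single i 1) := by
    conv_lhs => rw [pi_eq_sum_univ' x]
    simp
  calc ∫ p, fderiv ℝ f (A p) (A' p) ∂μ = ∫ p, ∑ i, A' p i * g i p ∂μ := by
        congr with p
        exact hexp _ _
    _ = ∑ i, ∫ p, A' p i * g i p ∂μ := integral_finsetSum _ fun i _ ↦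
        ((ModerateGrowth.clm ((ContinuousLinearMap.proj i).comp A')).mul (hg0 i)).integrable
          (by have := hgcont i; simp; fun_prop) μ
    _ = _ := Finset.sum_congr rfl fun i _ ↦ ?_
  let L : StrongDual ℝ V := (ContinuousLinearMap.proj i).comp A'
  rw [show ∫ p, A' p i * g i p ∂μ = ∫ p, L p * g i p ∂μ from rfl,
    integral_dual_mul_eq_integral_fderiv μ hμ L (hgc i) (hg0 i) (hg1 i)]
  have hA (j : ι) : A (∫ q, L q • q ∂μ) j = ∫ q, A' q i * A q j ∂μ := by
    have := ((ContinuousLinearMap.proj (R := ℝ) (φ := fun _ : ι ↦ ℝ) j).comp A).integral_comp_comm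
      (integrable_dual_smul_self μ L)
    simpa [L] using this.symm
  have hint (j : ι) : Integrable (fun p ↦ fderiv ℝ (fun y ↦ fderiv ℝ f y (Pi.single i 1)) (A p)
      (Pi.single j 1)) μ := by
    simp only [hflip, ContinuousLinearMap.flip_apply]
    refine ModerateGrowth.integrable ((hf2.comp_clm A).of_norm_le
      (K := ‖(Pi.single j 1 : ι → ℝ)‖ * ‖(Pi.single i 1 : ι → ℝ)‖) (by positivity) fun p ↦ ?_)
      (by fun_prop) μ
    refine ((fderiv ℝ (fderiv ℝ f) (A p)).le_opNorm₂ _ _).trans_eq (by ring)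
  simp_rw [← hA, ← integral_const_mul]
  rw [← integral_finsetSum _ fun j _ ↦ (hint j).const_mul _]
  congr with p
  rw [← hexp, hgd, hflip]
  rfl

lemma hasDerivAt_integral_interpolation {E : Type*} [NormedAddCommGroup E] [NormedSpace ℝ E]
    [CompleteSpace E] [SecondCountableTopology E] [MeasurableSpace E] [BorelSpace E]
    (μ : Measure (E × E)) [IsGaussian μ] {f : E → ℝ} (hf : ContDiff ℝ 1 f)
    (hf0 : ModerateGrowth f) (hf1 : ModerateGrowth (fderiv ℝ f))
    {t : ℝ} (ht : t ∈ Set.Ioo (0 : ℝ) 1) :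
    HasDerivAt (fun s ↦ ∫ p, f (√s • p.1 + √(1 - s) • p.2) ∂μ)
      (∫ p, fderiv ℝ f (√t • p.1 + √(1 - t) • p.2)
        ((1 / (2 * √t)) • p.1 - (1 / (2 * √(1 - t))) • p.2) ∂μ) t := by
  obtain ⟨ht0, ht1⟩ := ht
  obtain ⟨c, hc, hint⟩ := IsGaussian.exists_integrable_exp_sq μ
  obtain ⟨C, hC⟩ := hf1 (c / 8) (by positivity)
  obtain ⟨C', hC'⟩ := ModerateGrowth.id (E := E × E) (c / 2) (by positivity)
  have hfc := hf.continuous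
  have hfc' : Continuous (fderiv ℝ f) := hf.continuous_fderiv one_ne_zero
  have hpath (s : ℝ) (hs1 : s ≤ 1) (hs0 : 0 ≤ s) (p : E × E) :
      ‖√s • p.1 + √(1 - s) • p.2‖ ≤ 0 + 2 * ‖p‖ := by
    have h1 : √s ≤ 1 := Real.sqrt_le_one.2 hs1
    have h2 : √(1 - s) ≤ 1 := Real.sqrt_le_one.2 (by linarith)
    calc ‖√s • p.1 + √(1 - s) • p.2‖ ≤ √s * ‖p.1‖ + √(1 - s) * ‖p.2‖ := by
          refine (norm_add_le _ _).trans_eq ?_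
          simp [norm_smul, abs_of_nonneg (Real.sqrt_nonneg _)]
      _ ≤ 1 * ‖p‖ + 1 * ‖p‖ := by
          gcongr
          exacts [norm_fst_le p, norm_snd_le p]
      _ = _ := by ring
  set K := 1 / (2 * √(t / 2)) + 1 / (2 * √((1 - t) / 2)) with hK
  have hK0 : 0 ≤ K := by positivity
  have hvel (s : ℝ) (hs0 : t / 2 < s) (hs1 : s < (1 + t) / 2) (p : E × E) :
      ‖(1 / (2 * √s)) • p.1 - (1 / (2 * √(1 - s))) • p.2‖ ≤ K * ‖p‖ := by
    have h1 : 0 < √(t / 2) := Real.sqrt_pos.2 (by linarith)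
    have h2 : 0 < √((1 - t) / 2) := Real.sqrt_pos.2 (by linarith)
    calc _ ≤ 1 / (2 * √s) * ‖p.1‖ + 1 / (2 * √(1 - s)) * ‖p.2‖ := by
          refine (norm_sub_le _ _).trans_eq ?_
          rw [norm_smul, norm_smul, Real.norm_of_nonneg (by positivity),
            Real.norm_of_nonneg (by positivity)]
      _ ≤ 1 / (2 * √(t / 2)) * ‖p‖ + 1 / (2 * √((1 - t) / 2)) * ‖p‖ := by
          gcongr
          · exact norm_fst_le p
          · linarith
          · exact norm_snd_le p
      _ = _ := by rw [hK]; ring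
  refine (hasDerivAt_integral_of_dominated_loc_of_deriv_le
    (F := fun s (p : E × E) ↦ f (√s • p.1 + √(1 - s) • p.2))
    (F' := fun s (p : E × E) ↦ fderiv ℝ f (√s • p.1 + √(1 - s) • p.2)
        ((1 / (2 * √s)) • p.1 - (1 / (2 * √(1 - s))) • p.2))
    (bound := fun p ↦ C * K * C' * Real.exp (c * ‖p‖ ^ 2))
    (Ioo_mem_nhds (show t / 2 < t by linarith) (show t < (1 + t) / 2 by linarith))
    (.of_forall fun s ↦ Continuous.aestronglyMeasurable (by fun_prop))
    (ModerateGrowth.integrable (hf0.comp (hpath t ht1.le ht0.le)) (by fun_prop) μ)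
    (Continuous.aestronglyMeasurable (by fun_prop))
    (.of_forall fun p s hs ↦ ?_) (hint.const_mul _) (.of_forall fun p s hs ↦ ?_)).2
  · have hs0 : 0 ≤ s := by linarith [hs.1]
    have hs1 : s ≤ 1 := by linarith [hs.2]
    have hC0 : 0 ≤ C := by simpa using (norm_nonneg _).trans (hC 0)
    calc _ ≤ ‖fderiv ℝ f (√s • p.1 + √(1 - s) • p.2)‖ *
            ‖(1 / (2 * √s)) • p.1 - (1 / (2 * √(1 - s))) • p.2‖ :=
          ContinuousLinearMap.le_opNorm _ _
      _ ≤ (C * Real.exp (c / 8 * (2 * ‖p‖) ^ 2)) * (K * (C' * Real.exp (c / 2 * ‖p‖ ^ 2))) := by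
          refine mul_le_mul ((hC _).trans ?_) ((hvel s hs.1 hs.2 p).trans ?_) (norm_nonneg _)
            (by positivity)
          · gcongr
            simpa using hpath s hs1 hs0 p
          · gcongr
            exact hC' p
      _ = C * K * C' * (Real.exp (c / 8 * (2 * ‖p‖) ^ 2) * Real.exp (c / 2 * ‖p‖ ^ 2)) := by ring
      _ = _ := by
          rw [← Real.exp_add]
          ring_nf
  · have hs0 : s ≠ 0 := by linarith [hs.1]
    have hs1 : 1 - s ≠ 0 := by linarith [hs.2]
    have h1 := (Real.hasDerivAt_sqrt hs0).smul_const p.1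
    have h2 := (((hasDerivAt_id s).const_sub 1).sqrt hs1).smul_const p.2
    have h3 : HasDerivAt (fun s ↦ √s • p.1 + √(1 - s) • p.2)
        ((1 / (2 * √s)) • p.1 - (1 / (2 * √(1 - s))) • p.2) s :=
      (h1.add h2).congr_deriv (by simp [neg_div, sub_eq_add_neg])
    exact (hf.differentiable one_ne_zero _).hasFDerivAt.comp_hasDerivAt s h3

variable {Ω : Type*} {mΩ : MeasurableSpace Ω} {P : Measure Ω} {ι : Type*} [Fintype ι]

lemma map_coord_eq_gaussianReal [DecidableEq ι] {X : ι → Ω → ℝ}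
    (hX : ∀ d : ι → ℝ, ∃ v : NNReal, P.map (fun ω ↦ ∑ i, d i * X i ω) = gaussianReal 0 v)
    (i : ι) : ∃ v : NNReal, P.map (X i) = gaussianReal 0 v := by
  obtain ⟨v, hv⟩ := hX (Pi.single i 1)
  exact ⟨v, by simpa [Pi.single_apply] using hv⟩

lemma aemeasurable_of_map_eq_gaussianReal {Y : Ω → ℝ} {m : ℝ} {v : NNReal}
    (hY : P.map Y = gaussianReal m v) : AEMeasurable Y P :=
  .of_map_ne_zero (by rw [hY]; exact IsProbabilityMeasure.ne_zero _)

lemma integral_eq_of_map_eq_gaussianReal {Y : Ω → ℝ} {m : ℝ} {v : NNReal}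
    (hY : P.map Y = gaussianReal m v) : ∫ ω, Y ω ∂P = m := by
  have h := integral_map (f := fun x ↦ x) (aemeasurable_of_map_eq_gaussianReal hY)
    (by fun_prop)
  rw [← h, hY, integral_id_gaussianReal]

lemma hasGaussianLaw_of_forall_map_sum [DecidableEq ι] {X : ι → Ω → ℝ}
    (hX : ∀ d : ι → ℝ, ∃ v : NNReal, P.map (fun ω ↦ ∑ i, d i * X i ω) = gaussianReal 0 v) :
    HasGaussianLaw (fun ω i ↦ X i ω) P where
  isGaussian_map := by
    have hm : AEMeasurable (fun ω i ↦ X i ω) P := aemeasurable_pi_lambda _ fun i ↦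
      aemeasurable_of_map_eq_gaussianReal (map_coord_eq_gaussianReal hX i).choose_spec
    refine isGaussian_of_map_eq_gaussianReal fun L ↦ ?_
    obtain ⟨v, hv⟩ := hX fun i ↦ L (Pi.single i 1)
    refine ⟨0, v, ?_⟩
    rw [AEMeasurable.map_map_of_aemeasurable (by fun_prop) hm, ← hv]
    congr with ω
    rw [Function.comp_apply, pi_eq_sum_univ' (fun i ↦ X i ω)]
    simp [mul_comm]

end Interpolation

theorem stmt9 {Ω : Type*} [MeasureSpace Ω] [IsProbabilityMeasure (ℙ : Measure Ω)]
    {n : ℕ} (G B : Fin n → Ω → ℝ)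
    (hindep : IndepFun (fun ω i => G i ω) (fun ω i => B i ω) ℙ)
    (hG : ∀ d : Fin n → ℝ, ∃ v : NNReal,
      Measure.map (fun ω => ∑ i, d i * G i ω) ℙ = gaussianReal 0 v)
    (hB : ∀ d : Fin n → ℝ, ∃ v : NNReal,
      Measure.map (fun ω => ∑ i, d i * B i ω) ℙ = gaussianReal 0 v)
    (f : (Fin n → ℝ) → ℝ) (hf : ContDiff ℝ (⊤ : ℕ∞) f)
    (hgrowth : ∀ (m : ℕ) (a : ℝ), 0 < a →
      Filter.Tendsto (fun x : Fin n → ℝ => ‖iteratedFDeriv ℝ m f x‖ * Real.exp (-a * ‖x‖ ^ 2))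
        (Filter.cocompact _) (nhds 0))
    (ζ : ℝ → ℝ)
    (hζ : ∀ t, ζ t = ∫ ω, f (fun i => Real.sqrt t * G i ω + Real.sqrt (1 - t) * B i ω))
    (t : ℝ) (ht : t ∈ Set.Ioo (0:ℝ) 1) :
    HasDerivAt ζ
      ((1/2) * ∑ i, ∑ j,
        ((∫ ω, G i ω * G j ω) - ∫ ω, B i ω * B j ω) *
          ∫ ω, fderiv ℝ (fun y => fderiv ℝ f y (Pi.single j 1))
            (fun i' => Real.sqrt t * G i' ω + Real.sqrt (1 - t) * B i' ω) (Pi.single i 1)) t := by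
  have hGL := hasGaussianLaw_of_forall_map_sum hG
  have hBL := hasGaussianLaw_of_forall_map_sum hB
  have hGm (i : Fin n) : AEMeasurable (G i) ℙ := (hGL.eval i).aemeasurable
  have hBm (i : Fin n) : AEMeasurable (B i) ℙ := (hBL.eval i).aemeasurable
  have hG0 (i : Fin n) : ∫ ω, G i ω = 0 :=
    integral_eq_of_map_eq_gaussianReal (map_coord_eq_gaussianReal hG i).choose_spec
  have hB0 (i : Fin n) : ∫ ω, B i ω = 0 :=
    integral_eq_of_map_eq_gaussianReal (map_coord_eq_gaussianReal hB i).choose_spec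
  have hGB (i j : Fin n) : ∫ ω, G i ω * B j ω = 0 := by
    have h : IndepFun (G i) (B j) ℙ :=
      hindep.comp (measurable_pi_apply i) (measurable_pi_apply j)
    rw [h.integral_fun_mul_eq_mul_integral (hGm i).aestronglyMeasurable
      (hBm j).aestronglyMeasurable, hG0, zero_mul]
  have hjoint := hindep.hasGaussianLaw hGL hBL
  have hpm := hjoint.aemeasurable
  set Z : Ω → (Fin n → ℝ) × (Fin n → ℝ) := fun ω ↦ (fun i ↦ G i ω, fun i ↦ B i ω) with hZ
  let μ := Measure.map Z ℙ
  have hμG : IsGaussian μ := hjoint.isGaussian_map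
  have htr {ψ : (Fin n → ℝ) × (Fin n → ℝ) → ℝ} (hψ : Continuous ψ) :
      ∫ p, ψ p ∂μ = ∫ ω, ψ (Z ω) := integral_map hpm hψ.aestronglyMeasurable
  have hμ0 : ∫ p, p ∂μ = 0 := by
    have hint : Integrable (fun p ↦ p) μ := IsGaussian.integrable_id
    refine Prod.ext ?_ ?_
    · ext i
      have h := ((ContinuousLinearMap.proj (R := ℝ) (φ := fun _ : Fin n ↦ ℝ) i).comp
        (ContinuousLinearMap.fst ℝ (Fin n → ℝ) (Fin n → ℝ))).integral_comp_comm hint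
      rw [htr (by fun_prop)] at h
      exact h.symm.trans (hG0 i)
    · ext i
      have h := ((ContinuousLinearMap.proj (R := ℝ) (φ := fun _ : Fin n ↦ ℝ) i).comp
        (ContinuousLinearMap.snd ℝ (Fin n → ℝ) (Fin n → ℝ))).integral_comp_comm hint
      rw [htr (by fun_prop)] at h
      exact h.symm.trans (hB0 i)
  have hf2 : ContDiff ℝ 2 f := hf.of_le (WithTop.coe_le_coe.2 le_top)
  have hdf : ContDiff ℝ 1 (fderiv ℝ f) := hf2.fderiv_right (by norm_num)
  have hg0 : ModerateGrowth f :=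
    .of_tendsto hf.continuous fun a ha ↦ by simpa using hgrowth 0 a ha
  have hg1 : ModerateGrowth (fderiv ℝ f) :=
    .of_tendsto hdf.continuous fun a ha ↦ by simpa [norm_iteratedFDeriv_one] using hgrowth 1 a ha
  have hg2 : ModerateGrowth (fderiv ℝ (fderiv ℝ f)) :=
    .of_tendsto (hdf.continuous_fderiv one_ne_zero) fun a ha ↦ by
      simpa [← norm_iteratedFDeriv_fderiv, norm_iteratedFDeriv_one] using hgrowth (1 + 1) a ha
  let A : (Fin n → ℝ) × (Fin n → ℝ) →L[ℝ] Fin n → ℝ :=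
    √t • ContinuousLinearMap.fst ℝ _ _ + √(1 - t) • ContinuousLinearMap.snd ℝ _ _
  let A' : (Fin n → ℝ) × (Fin n → ℝ) →L[ℝ] Fin n → ℝ :=
    (1 / (2 * √t)) • ContinuousLinearMap.fst ℝ _ _ -
      (1 / (2 * √(1 - t))) • ContinuousLinearMap.snd ℝ _ _
  have hcov (i j : Fin n) : ∫ q, A' q i * A q j ∂μ =
      1 / 2 * ((∫ ω, G i ω * G j ω) - ∫ ω, B i ω * B j ω) := by
    have hGi (i : Fin n) : MemLp (G i) 2 ℙ := (hGL.eval i).memLp_two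
    have hBi (i : Fin n) : MemLp (B i) 2 ℙ := (hBL.eval i).memLp_two
    have ht0 : √t ≠ 0 := (Real.sqrt_pos.2 ht.1).ne'
    have ht1 : √(1 - t) ≠ 0 := (Real.sqrt_pos.2 (sub_pos.2 ht.2)).ne'
    rw [htr (by fun_prop)]
    have hexp (ω : Ω) : A' (Z ω) i * A (Z ω) j =
        1 / 2 * (G i ω * G j ω) - 1 / 2 * (B i ω * B j ω) +
        (√(1 - t) / (2 * √t) * (G i ω * B j ω) - √t / (2 * √(1 - t)) * (G j ω * B i ω)) := by
      simp [A, A', hZ]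
      field_simp
      ring
    have i1 := ((hGi i).integrable_mul (hGi j)).const_mul (1 / 2)
    have i2 := ((hBi i).integrable_mul (hBi j)).const_mul (1 / 2)
    have i3 := ((hGi i).integrable_mul (hBi j)).const_mul (√(1 - t) / (2 * √t))
    have i4 := ((hGi j).integrable_mul (hBi i)).const_mul (√t / (2 * √(1 - t)))
    simp only [Pi.mul_apply] at i1 i2 i3 i4
    simp_rw [hexp]
    rw [integral_add (by exact i1.sub i2) (by exact i3.sub i4), integral_sub i1 i2,
      integral_sub i3 i4]
    simp only [integral_const_mul, hGB]
    ring
  have key := hasDerivAt_integral_interpolation μ (hf2.of_le one_le_two) hg0 hg1 ht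
  have hζ' : ζ = fun s ↦ ∫ p, f (√s • p.1 + √(1 - s) • p.2) ∂μ := by
    ext s
    have := hf.continuous
    rw [hζ, htr (by fun_prop)]
    rfl
  rw [hζ']
  refine key.congr_deriv ((integral_fderiv_clm_eq_sum μ hμ0 A A' hf2 hg1 hg2).trans ?_)
  rw [Finset.sum_comm, Finset.mul_sum]
  refine Finset.sum_congr rfl fun i _ ↦ ?_
  rw [Finset.mul_sum]
  refine Finset.sum_congr rfl fun j _ ↦ ?_
  have hc : Continuous (fun y ↦
      fderiv ℝ (fun y ↦ fderiv ℝ f y (Pi.single j 1)) y (Pi.single i 1)) :=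
    ((hdf.clm_apply contDiff_const).continuous_fderiv one_ne_zero).clm_apply continuous_const
  rw [hcov, htr (ψ := fun p ↦ fderiv ℝ (fun y ↦ fderiv ℝ f y (Pi.single j 1)) (A p) (Pi.single i 1))
    (hc.comp A.continuous), mul_assoc]
  simp only [mul_comm (G j _), mul_comm (B j _)]
  rfl
end

section
/- If G is a centered Gaussian vector in ℝⁿ and f: ℝⁿ → ℝ is smooth of moderate growth, then E[f(G)] − f(0) = (1/2)·∑_{i,j} E[G_iG_j] · ∫_0^1 E[∂²f/∂x_i∂x_j (√t·G)] dt. -/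
open MeasureTheory ProbabilityTheory

section GaussianInterpolation

variable {E : Type*} [NormedAddCommGroup E]

/-- A continuous function which vanishes at infinity after multiplication by `exp (-a ‖x‖ ^ 2)` is
bounded by a multiple of `exp (a ‖x‖ ^ 2)`. -/
lemma exists_le_mul_exp_sq_of_tendsto_cocompact {g : E → ℝ} (hg : Continuous g) {a : ℝ}
    (h : Filter.Tendsto (fun x ↦ g x * Real.exp (-a * ‖x‖ ^ 2)) (Filter.cocompact E) (nhds 0)) :
    ∃ C, 0 ≤ C ∧ ∀ x, g x ≤ C * Real.exp (a * ‖x‖ ^ 2) := by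
  have hev : ∀ᶠ x in Filter.cocompact E, g x * Real.exp (-a * ‖x‖ ^ 2) < 1 :=
    h.eventually (gt_mem_nhds one_pos)
  obtain ⟨K, hK, hKsub⟩ := Filter.mem_cocompact.1 hev
  obtain ⟨C, hC⟩ := hK.exists_bound_of_continuousOn
    (f := fun x ↦ g x * Real.exp (-a * ‖x‖ ^ 2)) (by fun_prop)
  refine ⟨max C 1, by positivity, fun x ↦ ?_⟩
  have hx : g x * Real.exp (-a * ‖x‖ ^ 2) ≤ max C 1 := by
    by_cases hxK : x ∈ K
    · exact (le_abs_self _).trans ((hC x hxK).trans (le_max_left _ _))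
    · exact (hKsub hxK).le.trans (le_max_right _ _)
  calc g x = g x * Real.exp (-a * ‖x‖ ^ 2) * Real.exp (a * ‖x‖ ^ 2) := by
        rw [mul_assoc, ← Real.exp_add]; simp
    _ ≤ max C 1 * Real.exp (a * ‖x‖ ^ 2) := by gcongr

/-- A function of moderate growth, evaluated at points of norm at most `2 * r` and multiplied by
`1 + r ^ 2`, is bounded by a multiple of `exp (c * r ^ 2)`. -/
lemma exists_mul_one_add_sq_le_mul_exp_sq {g : E → ℝ} (hg : Continuous g)
    (h : ∀ a : ℝ, 0 < a → Filter.Tendsto (fun x ↦ g x * Real.exp (-a * ‖x‖ ^ 2))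
      (Filter.cocompact E) (nhds 0)) {c : ℝ} (hc : 0 < c) :
    ∃ B, 0 ≤ B ∧ ∀ (r : ℝ) (w : E), ‖w‖ ≤ 2 * r → g w * (1 + r ^ 2) ≤ B * Real.exp (c * r ^ 2) := by
  obtain ⟨C, hC0, hC⟩ := exists_le_mul_exp_sq_of_tendsto_cocompact hg (h (c / 8) (by positivity))
  refine ⟨C * (1 + 2 / c), by positivity, fun r w hw ↦ ?_⟩
  have h1 : g w ≤ C * Real.exp (c / 2 * r ^ 2) := by
    refine (hC w).trans ?_
    gcongr C * Real.exp ?_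
    calc c / 8 * ‖w‖ ^ 2 ≤ c / 8 * (2 * r) ^ 2 := by gcongr
      _ = c / 2 * r ^ 2 := by ring
  have h2 : 1 + r ^ 2 ≤ (1 + 2 / c) * Real.exp (c / 2 * r ^ 2) := by
    have h3 : 1 + r ^ 2 ≤ (1 + 2 / c) * (c / 2 * r ^ 2 + 1) := by
      have : (1 + 2 / c) * (c / 2 * r ^ 2 + 1) = 1 + r ^ 2 + (c / 2 * r ^ 2 + 2 / c) := by
        field_simp; ring
      rw [this]
      have : 0 ≤ c / 2 * r ^ 2 + 2 / c := by positivity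
      linarith
    refine h3.trans ?_
    gcongr
    exact Real.add_one_le_exp _
  calc g w * (1 + r ^ 2)
      ≤ (C * Real.exp (c / 2 * r ^ 2)) * ((1 + 2 / c) * Real.exp (c / 2 * r ^ 2)) := by gcongr
    _ = C * (1 + 2 / c) * (Real.exp (c / 2 * r ^ 2) * Real.exp (c / 2 * r ^ 2)) := by ring
    _ = C * (1 + 2 / c) * Real.exp (c * r ^ 2) := by rw [← Real.exp_add]; ring_nf

variable [NormedSpace ℝ E]

lemma rotation_hasDerivAt_fst (z : E × E) (θ : ℝ) :
    HasDerivAt (fun θ ↦ (ContinuousLinearMap.rotation θ z).1)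
      (ContinuousLinearMap.rotation θ z).2 θ := by
  simp only [ContinuousLinearMap.rotation_apply]
  exact ((Real.hasDerivAt_cos θ).smul_const z.1).add ((Real.hasDerivAt_sin θ).smul_const z.2)

lemma rotation_hasDerivAt_snd (z : E × E) (θ : ℝ) :
    HasDerivAt (fun θ ↦ (ContinuousLinearMap.rotation θ z).2)
      (-(ContinuousLinearMap.rotation θ z).1) θ := by
  simp only [ContinuousLinearMap.rotation_apply]
  convert! ((Real.hasDerivAt_sin θ).neg.smul_const z.1).add
    ((Real.hasDerivAt_cos θ).smul_const z.2) using 1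
  module

lemma norm_rotation_le (z : E × E) (θ : ℝ) :
    ‖ContinuousLinearMap.rotation θ z‖ ≤ 2 * ‖z‖ := by
  have key (a b : ℝ) (ha : |a| ≤ 1) (hb : |b| ≤ 1) : ‖a • z.1 + b • z.2‖ ≤ 2 * ‖z‖ := by
    calc ‖a • z.1 + b • z.2‖ ≤ |a| * ‖z.1‖ + |b| * ‖z.2‖ := by
          simpa only [norm_smul, Real.norm_eq_abs] using norm_add_le (a • z.1) (b • z.2)
      _ ≤ 1 * ‖z‖ + 1 * ‖z‖ := by
          gcongr
          exacts [norm_fst_le z, norm_snd_le z]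
      _ = 2 * ‖z‖ := by ring
  rw [ContinuousLinearMap.rotation_apply]
  exact norm_prod_le_iff.2 ⟨key _ _ (Real.abs_cos_le_one θ) (Real.abs_sin_le_one θ),
    key _ _ (by simpa using Real.abs_sin_le_one θ) (Real.abs_cos_le_one θ)⟩

lemma norm_smul_fst_le {s : ℝ} (hs : s ∈ Set.Icc (0 : ℝ) 1) (z : E × E) :
    ‖s • z.1‖ ≤ 2 * ‖z‖ := by
  rw [norm_smul, Real.norm_of_nonneg hs.1]
  have := norm_fst_le z
  nlinarith [hs.1, hs.2, norm_nonneg z.1, norm_nonneg z]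

variable [MeasurableSpace E] [BorelSpace E] [SecondCountableTopology E]
  {ν : Measure (E × E)} {f : E → ℝ} {bound : E × E → ℝ}

/-- Gaussian integration by parts, for a rotation invariant measure on `E × E`. -/
lemma integral_fderiv_apply_fst_eq_of_map_rotation_eq_self
    (hν : ∀ θ : ℝ, ν.map (ContinuousLinearMap.rotation θ) = ν)
    (hf : ContDiff ℝ 2 f) (hbound : Integrable bound ν)
    (h1 : ∀ z w, ‖w‖ ≤ 2 * ‖z‖ → ‖fderiv ℝ f w‖ * (1 + ‖z‖ ^ 2) ≤ bound z)
    (h2 : ∀ z w, ‖w‖ ≤ 2 * ‖z‖ → ‖fderiv ℝ (fderiv ℝ f) w‖ * (1 + ‖z‖ ^ 2) ≤ bound z)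
    {s : ℝ} (hs : s ∈ Set.Icc (0 : ℝ) 1) :
    ∫ z, fderiv ℝ f (s • z.1) z.1 ∂ν =
      s * ∫ z, fderiv ℝ (fderiv ℝ f) (s • z.1) z.2 z.2 ∂ν := by
  have hf1 : ContDiff ℝ 1 (fderiv ℝ f) := hf.fderiv_right (by norm_num)
  have hc1 : Continuous (fderiv ℝ f) := hf1.continuous
  have hc2 : Continuous (fderiv ℝ (fderiv ℝ f)) := hf1.continuous_fderiv (by norm_num)
  let R (θ : ℝ) (z : E × E) : E × E := ContinuousLinearMap.rotation θ z
  let F (θ : ℝ) (z : E × E) : ℝ := fderiv ℝ f (s • (R θ z).1) (R θ z).2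
  let F' (θ : ℝ) (z : E × E) : ℝ :=
    fderiv ℝ (fderiv ℝ f) (s • (R θ z).1) (s • (R θ z).2) (R θ z).2 +
      fderiv ℝ f (s • (R θ z).1) (-(R θ z).1)
  have hRn (θ : ℝ) (z : E × E) : ‖R θ z‖ ≤ 2 * ‖z‖ := norm_rotation_le z θ
  have hsR (θ : ℝ) (z : E × E) : ‖s • (R θ z).1‖ ≤ 2 * ‖z‖ := by
    rw [norm_smul, Real.norm_of_nonneg hs.1]
    have := (norm_fst_le (R θ z)).trans (hRn θ z)
    nlinarith [hs.1, hs.2, norm_nonneg (R θ z).1]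
  have hR0 (z : E × E) : R 0 z = z := by simp [R, ContinuousLinearMap.rotation_apply]
  have hRc (θ : ℝ) : Continuous (R θ) := (ContinuousLinearMap.rotation θ).continuous
  have hFc (θ : ℝ) : Continuous (F θ) := by
    have := hRc θ
    fun_prop
  have hF'c (θ : ℝ) : Continuous (F' θ) := by
    have := hRc θ
    fun_prop
  have hX1 (z : E × E) (w v : E) (hw : ‖w‖ ≤ 2 * ‖z‖) (hv : ‖v‖ ≤ 2 * ‖z‖) :
      ‖fderiv ℝ f w v‖ ≤ bound z :=
    calc ‖fderiv ℝ f w v‖ ≤ ‖fderiv ℝ f w‖ * ‖v‖ := ContinuousLinearMap.le_opNorm _ _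
      _ ≤ ‖fderiv ℝ f w‖ * (1 + ‖z‖ ^ 2) := by
        gcongr
        nlinarith [sq_nonneg (‖z‖ - 1)]
      _ ≤ bound z := h1 z w hw
  have hX2 (z : E × E) (w u v : E) (hw : ‖w‖ ≤ 2 * ‖z‖) (hu : ‖u‖ ≤ 2 * ‖z‖)
      (hv : ‖v‖ ≤ 2 * ‖z‖) : ‖fderiv ℝ (fderiv ℝ f) w u v‖ ≤ 4 * bound z :=
    calc ‖fderiv ℝ (fderiv ℝ f) w u v‖ ≤ ‖fderiv ℝ (fderiv ℝ f) w‖ * ‖u‖ * ‖v‖ :=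
        ContinuousLinearMap.le_opNorm₂ _ _ _
      _ ≤ ‖fderiv ℝ (fderiv ℝ f) w‖ * (2 * ‖z‖) * (2 * ‖z‖) := by gcongr
      _ ≤ 4 * (‖fderiv ℝ (fderiv ℝ f) w‖ * (1 + ‖z‖ ^ 2)) := by
        nlinarith [norm_nonneg (fderiv ℝ (fderiv ℝ f) w)]
      _ ≤ 4 * bound z := by gcongr; exact h2 z w hw
  have hconst (θ : ℝ) : ∫ z, F θ z ∂ν = ∫ z, fderiv ℝ f (s • z.1) z.2 ∂ν := by
    conv_rhs => rw [← hν θ]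
    rw [integral_map (by fun_prop) (Continuous.aestronglyMeasurable (by fun_prop))]
  have hderiv := hasDerivAt_integral_of_dominated_loc_of_deriv_le (μ := ν) (F := F) (F' := F')
    (x₀ := 0) (s := Set.univ) (bound := fun z ↦ 5 * bound z) Filter.univ_mem
    (Filter.Eventually.of_forall fun θ ↦ (hFc θ).aestronglyMeasurable)
    (hbound.mono' (hFc 0).aestronglyMeasurable (Filter.Eventually.of_forall fun z ↦
      hX1 z _ _ (hsR 0 z) ((norm_snd_le _).trans (hRn 0 z))))
    (hF'c 0).aestronglyMeasurable
    (Filter.Eventually.of_forall fun z θ _ ↦ by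
      refine (norm_add_le _ _).trans ?_
      have hs2 : ‖s • (R θ z).2‖ ≤ 2 * ‖z‖ := by
        rw [norm_smul, Real.norm_of_nonneg hs.1]
        have := (norm_snd_le (R θ z)).trans (hRn θ z)
        nlinarith [hs.1, hs.2, norm_nonneg (R θ z).2]
      have e1 := hX1 z _ (-(R θ z).1) (hsR θ z)
        (by rw [norm_neg]; exact (norm_fst_le _).trans (hRn θ z))
      have e2 := hX2 z _ _ _ (hsR θ z) hs2 ((norm_snd_le _).trans (hRn θ z))
      linarith)
    (hbound.const_mul 5)
    (Filter.Eventually.of_forall fun z θ _ ↦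
      (((hf1.differentiable (by norm_num) _).hasFDerivAt.comp_hasDerivAt θ
        ((rotation_hasDerivAt_fst z θ).const_smul s)).clm_apply (rotation_hasDerivAt_snd z θ)))
  have hzero : ∫ z, F' 0 z ∂ν = 0 := by
    refine hderiv.2.unique ?_
    simp only [hconst]
    exact hasDerivAt_const _ _
  have hi2 : Integrable (fun z : E × E ↦ fderiv ℝ (fderiv ℝ f) (s • z.1) z.2 z.2) ν :=
    (hbound.const_mul 4).mono' (Continuous.aestronglyMeasurable (by fun_prop))
      (Filter.Eventually.of_forall fun z ↦ hX2 z _ _ _ (norm_smul_fst_le hs z)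
        (by linarith [norm_snd_le z, norm_nonneg z]) (by linarith [norm_snd_le z, norm_nonneg z]))
  have hi1 : Integrable (fun z : E × E ↦ fderiv ℝ f (s • z.1) z.1) ν :=
    hbound.mono' (Continuous.aestronglyMeasurable (by fun_prop))
      (Filter.Eventually.of_forall fun z ↦ hX1 z _ _ (norm_smul_fst_le hs z)
        (by linarith [norm_fst_le z, norm_nonneg z]))
  have hF'0 : F' 0 = fun z ↦ s * fderiv ℝ (fderiv ℝ f) (s • z.1) z.2 z.2 -
      fderiv ℝ f (s • z.1) z.1 := by
    ext z
    simp [F', hR0, sub_eq_add_neg]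
  rw [hF'0, integral_sub (hi2.const_mul s) hi1, integral_const_mul] at hzero
  linarith

/-- The Gaussian interpolation formula, for a rotation invariant measure on `E × E`. -/
lemma integral_sub_eq_half_integral_of_map_rotation_eq_self [IsProbabilityMeasure ν]
    (hν : ∀ θ : ℝ, ν.map (ContinuousLinearMap.rotation θ) = ν)
    (hf : ContDiff ℝ 2 f) (hbound : Integrable bound ν)
    (h0 : ∀ z w, ‖w‖ ≤ 2 * ‖z‖ → ‖f w‖ * (1 + ‖z‖ ^ 2) ≤ bound z)
    (h1 : ∀ z w, ‖w‖ ≤ 2 * ‖z‖ → ‖fderiv ℝ f w‖ * (1 + ‖z‖ ^ 2) ≤ bound z)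
    (h2 : ∀ z w, ‖w‖ ≤ 2 * ‖z‖ → ‖fderiv ℝ (fderiv ℝ f) w‖ * (1 + ‖z‖ ^ 2) ≤ bound z) :
    ∫ z, f z.1 ∂ν - f 0 =
      (1 / 2) * ∫ t in (0 : ℝ)..1, ∫ z, fderiv ℝ (fderiv ℝ f) (√t • z.1) z.2 z.2 ∂ν := by
  have hf1 : ContDiff ℝ 1 (fderiv ℝ f) := hf.fderiv_right (by norm_num)
  have hc0 : Continuous f := hf.continuous
  have hc1 : Continuous (fderiv ℝ f) := hf1.continuous
  have hc2 : Continuous (fderiv ℝ (fderiv ℝ f)) := hf1.continuous_fderiv (by norm_num)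
  have hX0 (z : E × E) (s : ℝ) (hs : s ∈ Set.Icc (0 : ℝ) 1) : ‖f (s • z.1)‖ ≤ bound z := by
    refine le_trans ?_ (h0 z _ (norm_smul_fst_le hs z))
    nlinarith [norm_nonneg (f (s • z.1)), mul_nonneg (norm_nonneg (f (s • z.1))) (sq_nonneg ‖z‖)]
  have hX1 (z : E × E) (s : ℝ) (hs : s ∈ Set.Icc (0 : ℝ) 1) :
      ‖fderiv ℝ f (s • z.1) z.1‖ ≤ bound z :=
    calc ‖fderiv ℝ f (s • z.1) z.1‖ ≤ ‖fderiv ℝ f (s • z.1)‖ * ‖z.1‖ :=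
        ContinuousLinearMap.le_opNorm _ _
      _ ≤ ‖fderiv ℝ f (s • z.1)‖ * (1 + ‖z‖ ^ 2) := by
        gcongr
        nlinarith [sq_nonneg (‖z‖ - 1), norm_fst_le z, norm_nonneg z]
      _ ≤ bound z := h1 z _ (norm_smul_fst_le hs z)
  have hX2 (z : E × E) (s : ℝ) (hs : s ∈ Set.Icc (0 : ℝ) 1) :
      ‖fderiv ℝ (fderiv ℝ f) (s • z.1) z.2 z.2‖ ≤ bound z :=
    calc ‖fderiv ℝ (fderiv ℝ f) (s • z.1) z.2 z.2‖
        ≤ ‖fderiv ℝ (fderiv ℝ f) (s • z.1)‖ * ‖z.2‖ * ‖z.2‖ :=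
        ContinuousLinearMap.le_opNorm₂ _ _ _
      _ ≤ ‖fderiv ℝ (fderiv ℝ f) (s • z.1)‖ * ‖z‖ * ‖z‖ := by
        gcongr <;> exact norm_snd_le z
      _ ≤ ‖fderiv ℝ (fderiv ℝ f) (s • z.1)‖ * (1 + ‖z‖ ^ 2) := by
        nlinarith [norm_nonneg (fderiv ℝ (fderiv ℝ f) (s • z.1))]
      _ ≤ bound z := h2 z _ (norm_smul_fst_le hs z)
  have hsqrt : Set.MapsTo Real.sqrt (Set.Icc 0 1) (Set.Icc 0 1) := fun t ht ↦
    ⟨Real.sqrt_nonneg t, Real.sqrt_le_one.2 ht.2⟩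
  have hcontφ : ContinuousOn (fun t : ℝ ↦ ∫ z, f (√t • z.1) ∂ν) (Set.Icc 0 1) :=
    continuousOn_of_dominated (bound := bound)
      (fun t _ ↦ Continuous.aestronglyMeasurable (by fun_prop))
      (fun t ht ↦ Filter.Eventually.of_forall fun z ↦ hX0 z _ (hsqrt ht)) hbound
      (Filter.Eventually.of_forall fun z ↦ Continuous.continuousOn (by fun_prop))
  have hcontψ : ContinuousOn
      (fun t : ℝ ↦ ∫ z, fderiv ℝ (fderiv ℝ f) (√t • z.1) z.2 z.2 ∂ν) (Set.Icc 0 1) :=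
    continuousOn_of_dominated (bound := bound)
      (fun t _ ↦ Continuous.aestronglyMeasurable (by fun_prop))
      (fun t ht ↦ Filter.Eventually.of_forall fun z ↦ hX2 z _ (hsqrt ht)) hbound
      (Filter.Eventually.of_forall fun z ↦ Continuous.continuousOn (by fun_prop))
  have hderivs (s : ℝ) (hs : s ∈ Set.Ioo (0 : ℝ) 1) :
      HasDerivAt (fun s : ℝ ↦ ∫ z, f (s • z.1) ∂ν) (∫ z, fderiv ℝ f (s • z.1) z.1 ∂ν) s :=
    (hasDerivAt_integral_of_dominated_loc_of_deriv_le (μ := ν)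
      (F := fun (s : ℝ) (z : E × E) ↦ f (s • z.1))
      (F' := fun (s : ℝ) (z : E × E) ↦ fderiv ℝ f (s • z.1) z.1)
      (s := Set.Ioo 0 1) (bound := bound) (isOpen_Ioo.mem_nhds hs)
      (Filter.Eventually.of_forall fun t ↦ Continuous.aestronglyMeasurable (by fun_prop))
      (hbound.mono' (Continuous.aestronglyMeasurable (by fun_prop))
        (Filter.Eventually.of_forall fun z ↦ hX0 z s (Set.Ioo_subset_Icc_self hs)))
      (Continuous.aestronglyMeasurable (by fun_prop))
      (Filter.Eventually.of_forall fun z t ht ↦ hX1 z t (Set.Ioo_subset_Icc_self ht))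
      hbound
      (Filter.Eventually.of_forall fun z t _ ↦ by
        have h := (hf.differentiable (by norm_num) (t • z.1)).hasFDerivAt.comp_hasDerivAt t
          ((hasDerivAt_id t).smul_const z.1)
        rwa [one_smul] at h)).2
  have hderivt (t : ℝ) (ht : t ∈ Set.Ioo (0 : ℝ) 1) :
      HasDerivAt (fun t : ℝ ↦ ∫ z, f (√t • z.1) ∂ν)
        ((1 / 2) * ∫ z, fderiv ℝ (fderiv ℝ f) (√t • z.1) z.2 z.2 ∂ν) t := by
    have hpos : 0 < √t := Real.sqrt_pos.2 ht.1
    have hmem : √t ∈ Set.Ioo (0 : ℝ) 1 :=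
      ⟨hpos, by rw [Real.sqrt_lt' one_pos]; simpa using ht.2⟩
    have h := (hderivs (√t) hmem).comp t (Real.hasDerivAt_sqrt ht.1.ne')
    rw [integral_fderiv_apply_fst_eq_of_map_rotation_eq_self hν hf hbound h1 h2
      (Set.Ioo_subset_Icc_self hmem)] at h
    convert! h using 1
    field_simp
  have hFTC := intervalIntegral.integral_eq_sub_of_hasDerivAt_of_le zero_le_one hcontφ hderivt
    ((continuousOn_const.mul hcontψ).intervalIntegrable_of_Icc zero_le_one)
  rw [intervalIntegral.integral_const_mul] at hFTC
  rw [hFTC]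
  simp

end GaussianInterpolation

/-- Integral form of the interpolation formula for a centered Gaussian measure on `Fin n → ℝ`. -/
lemma ProbabilityTheory.IsGaussian.integral_sub_eq_half_sum {n : ℕ} {μ : Measure (Fin n → ℝ)}
    [IsGaussian μ] (hμ : ∀ L : StrongDual ℝ (Fin n → ℝ), μ[L] = 0)
    {f : (Fin n → ℝ) → ℝ} (hf : ContDiff ℝ 2 f)
    (hgrowth : ∀ m ≤ 2, ∀ a : ℝ, 0 < a →
      Filter.Tendsto (fun x : Fin n → ℝ => ‖iteratedFDeriv ℝ m f x‖ * Real.exp (-a * ‖x‖ ^ 2))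
        (Filter.cocompact _) (nhds 0)) :
    ∫ x, f x ∂μ - f 0 =
      (1 / 2) * ∑ i, ∑ j, (∫ x, x i * x j ∂μ) *
        ∫ t in (0 : ℝ)..1, ∫ x, fderiv ℝ (fderiv ℝ f) (√t • x) (Pi.single i 1) (Pi.single j 1) ∂μ
    := by
  have hf1 : ContDiff ℝ 1 (fderiv ℝ f) := hf.fderiv_right (by norm_num)
  have hc0 : Continuous f := hf.continuous
  have hc1 : Continuous (fderiv ℝ f) := hf1.continuous
  have hc2 : Continuous (fderiv ℝ (fderiv ℝ f)) := hf1.continuous_fderiv (by norm_num)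
  obtain ⟨c, hc, hint⟩ := IsGaussian.exists_integrable_exp_sq (μ.prod μ)
  have e1 (x : Fin n → ℝ) : ‖iteratedFDeriv ℝ 1 f x‖ = ‖fderiv ℝ f x‖ := by
    rw [← zero_add 1, ← norm_iteratedFDeriv_fderiv, norm_iteratedFDeriv_zero]
  have e2 (x : Fin n → ℝ) : ‖iteratedFDeriv ℝ 2 f x‖ = ‖fderiv ℝ (fderiv ℝ f) x‖ := by
    rw [← one_add_one_eq_two, ← norm_iteratedFDeriv_fderiv, ← zero_add 1,
      ← norm_iteratedFDeriv_fderiv, norm_iteratedFDeriv_zero]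
  obtain ⟨B0, hB0, hb0⟩ := exists_mul_one_add_sq_le_mul_exp_sq (g := fun x ↦ ‖f x‖)
    (by fun_prop) (by simpa using hgrowth 0 (by norm_num)) hc
  obtain ⟨B1, hB1, hb1⟩ := exists_mul_one_add_sq_le_mul_exp_sq (g := fun x ↦ ‖fderiv ℝ f x‖)
    (by fun_prop) (by simpa only [e1] using hgrowth 1 (by norm_num)) hc
  obtain ⟨B2, hB2, hb2⟩ := exists_mul_one_add_sq_le_mul_exp_sq
    (g := fun x ↦ ‖fderiv ℝ (fderiv ℝ f) x‖)
    (continuous_norm (E := (Fin n → ℝ) →L[ℝ] (Fin n → ℝ) →L[ℝ] ℝ).comp hc2)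
    (by simpa only [e2] using hgrowth 2 le_rfl) hc
  let bound (z : (Fin n → ℝ) × (Fin n → ℝ)) : ℝ := (B0 + B1 + B2) * Real.exp (c * ‖z‖ ^ 2)
  have hbound : Integrable bound (μ.prod μ) := hint.const_mul _
  have h2 : ∀ (z : (Fin n → ℝ) × (Fin n → ℝ)) (w : Fin n → ℝ), ‖w‖ ≤ 2 * ‖z‖ →
      ‖fderiv ℝ (fderiv ℝ f) w‖ * (1 + ‖z‖ ^ 2) ≤ bound z := fun z w hw ↦
    (hb2 _ w hw).trans (by dsimp only [bound]; gcongr; linarith)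
  rw [show ∫ x, f x ∂μ = ∫ z, f z.1 ∂(μ.prod μ) by simp [integral_fun_fst],
    integral_sub_eq_half_integral_of_map_rotation_eq_self (bound := bound)
    (IsGaussian.map_rotation_eq_self_of_forall_strongDual_eq_zero hμ) hf hbound
    (fun z w hw ↦ (hb0 _ w hw).trans (by dsimp only [bound]; gcongr; linarith))
    (fun z w hw ↦ (hb1 _ w hw).trans (by dsimp only [bound]; gcongr; linarith)) h2]
  have hX2 (z : (Fin n → ℝ) × (Fin n → ℝ)) (i j : Fin n) (s : ℝ)
      (hs : s ∈ Set.Icc (0 : ℝ) 1) (q : ℝ) (hq : |q| ≤ 1 + ‖z‖ ^ 2) :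
      ‖fderiv ℝ (fderiv ℝ f) (s • z.1) (Pi.single i 1) (Pi.single j 1) * q‖ ≤ bound z := by
    refine le_trans ?_ (h2 z _ (norm_smul_fst_le hs z))
    rw [norm_mul]
    gcongr
    · exact (ContinuousLinearMap.le_opNorm₂ _ _ _).trans (by simp [Pi.norm_single])
    · exact hq
  have hsqrt : Set.MapsTo Real.sqrt (Set.Icc 0 1) (Set.Icc 0 1) := fun t ht ↦
    ⟨Real.sqrt_nonneg t, Real.sqrt_le_one.2 ht.2⟩
  have hcont (i j : Fin n) : ContinuousOn (fun t : ℝ ↦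
      ∫ x, fderiv ℝ (fderiv ℝ f) (√t • x) (Pi.single i 1) (Pi.single j 1) ∂μ) (Set.Icc 0 1) := by
    have : ContinuousOn (fun t : ℝ ↦ ∫ z, fderiv ℝ (fderiv ℝ f) (√t • z.1) (Pi.single i 1)
        (Pi.single j 1) ∂(μ.prod μ)) (Set.Icc 0 1) :=
      continuousOn_of_dominated (bound := bound)
        (fun t _ ↦ Continuous.aestronglyMeasurable (by fun_prop))
        (fun t ht ↦ Filter.Eventually.of_forall fun z ↦ by
          simpa using hX2 z i j _ (hsqrt ht) 1 (by simp)) hbound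
        (Filter.Eventually.of_forall fun z ↦ Continuous.continuousOn (by fun_prop))
    refine this.congr fun t _ ↦ ?_
    simp [integral_fun_fst fun x ↦
      fderiv ℝ (fderiv ℝ f) (√t • x) (Pi.single i 1) (Pi.single j 1)]
  have hexpand (t : ℝ) (ht : t ∈ Set.Icc (0 : ℝ) 1) :
      ∫ z, fderiv ℝ (fderiv ℝ f) (√t • z.1) z.2 z.2 ∂(μ.prod μ) =
        ∑ i, ∑ j, (∫ x, x i * x j ∂μ) *
          ∫ x, fderiv ℝ (fderiv ℝ f) (√t • x) (Pi.single i 1) (Pi.single j 1) ∂μ := by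
    have hpt (z : (Fin n → ℝ) × (Fin n → ℝ)) :
        fderiv ℝ (fderiv ℝ f) (√t • z.1) z.2 z.2 = ∑ i, ∑ j,
          fderiv ℝ (fderiv ℝ f) (√t • z.1) (Pi.single i 1) (Pi.single j 1) *
            (z.2 i * z.2 j) := by
      conv_lhs => rw [pi_eq_sum_univ' z.2]
      simp only [map_sum, map_smul, sum_apply, smul_apply,
        smul_eq_mul, Finset.mul_sum]
      rw [Finset.sum_comm]
      exact Finset.sum_congr rfl fun i _ ↦ Finset.sum_congr rfl fun j _ ↦ by ring
    have hi (i j : Fin n) : Integrable (fun z : (Fin n → ℝ) × (Fin n → ℝ) ↦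
        fderiv ℝ (fderiv ℝ f) (√t • z.1) (Pi.single i 1) (Pi.single j 1) * (z.2 i * z.2 j))
        (μ.prod μ) :=
      hbound.mono' (Continuous.aestronglyMeasurable (by fun_prop))
        (Filter.Eventually.of_forall fun z ↦ hX2 z i j _ (hsqrt ht) _ (by
          have hz (k : Fin n) : |z.2 k| ≤ ‖z‖ := (norm_le_pi_norm z.2 k).trans (norm_snd_le z)
          rw [abs_mul]
          nlinarith [hz i, hz j, abs_nonneg (z.2 i), abs_nonneg (z.2 j), norm_nonneg z]))
    simp_rw [hpt]
    rw [integral_finsetSum _ fun i _ ↦ integrable_finsetSum _ fun j _ ↦ hi i j]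
    refine Finset.sum_congr rfl fun i _ ↦ ?_
    rw [integral_finsetSum _ fun j _ ↦ hi i j]
    refine Finset.sum_congr rfl fun j _ ↦ ?_
    rw [mul_comm]
    exact integral_prod_mul (fun x ↦ fderiv ℝ (fderiv ℝ f) (√t • x) (Pi.single i 1)
      (Pi.single j 1)) (fun y : Fin n → ℝ ↦ y i * y j)
  have hii (i j : Fin n) : IntervalIntegrable (fun t : ℝ ↦ (∫ x, x i * x j ∂μ) *
      ∫ x, fderiv ℝ (fderiv ℝ f) (√t • x) (Pi.single i 1) (Pi.single j 1) ∂μ) volume 0 1 :=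
    (continuousOn_const.mul (hcont i j)).intervalIntegrable_of_Icc zero_le_one
  rw [intervalIntegral.integral_congr fun t ht ↦
      hexpand t (by rwa [Set.uIcc_of_le zero_le_one] at ht),
    intervalIntegral.integral_finsetSum fun i _ ↦ by
      simpa only [Finset.sum_fn] using IntervalIntegrable.sum Finset.univ fun j _ ↦ hii i j]
  congr 1
  refine Finset.sum_congr rfl fun i _ ↦ ?_
  rw [intervalIntegral.integral_finsetSum fun j _ ↦ hii i j]
  simp_rw [intervalIntegral.integral_const_mul]

theorem stmt10 {Ω : Type*} [MeasureSpace Ω] [IsProbabilityMeasure (ℙ : Measure Ω)]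
    {n : ℕ} (G : Fin n → Ω → ℝ)
    (hG : ∀ d : Fin n → ℝ, ∃ v : NNReal,
      Measure.map (fun ω => ∑ i, d i * G i ω) ℙ = gaussianReal 0 v)
    (f : (Fin n → ℝ) → ℝ) (hf : ContDiff ℝ (⊤ : ℕ∞) f)
    (hgrowth : ∀ (m : ℕ) (a : ℝ), 0 < a →
      Filter.Tendsto (fun x : Fin n → ℝ => ‖iteratedFDeriv ℝ m f x‖ * Real.exp (-a * ‖x‖ ^ 2))
        (Filter.cocompact _) (nhds 0)) :
    (∫ ω, f (fun i => G i ω)) - f 0 =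
      (1/2) * ∑ i, ∑ j, (∫ ω, G i ω * G j ω) *
        ∫ t in (0:ℝ)..1,
          ∫ ω, fderiv ℝ (fun y => fderiv ℝ f y (Pi.single j 1))
            (fun i' => Real.sqrt t * G i' ω) (Pi.single i 1) := by
  have hmeas (i : Fin n) : AEMeasurable (G i) ℙ := by
    obtain ⟨v, hv⟩ := hG (Pi.single i 1)
    have hsum : (fun ω ↦ ∑ k, (Pi.single i 1 : Fin n → ℝ) k * G k ω) = G i := by
      ext ω
      simp [Pi.single_apply]
    rw [hsum] at hv
    refine AEMeasurable.of_map_ne_zero ?_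
    rw [hv]
    exact IsProbabilityMeasure.ne_zero _
  have hGm : AEMeasurable (fun ω i ↦ G i ω) ℙ := aemeasurable_pi_lambda _ hmeas
  set μ : Measure (Fin n → ℝ) := Measure.map (fun ω i ↦ G i ω) ℙ with hμ
  have hmap (L : StrongDual ℝ (Fin n → ℝ)) : ∃ v : NNReal, μ.map L = gaussianReal 0 v := by
    obtain ⟨v, hv⟩ := hG fun i ↦ L (Pi.single i 1)
    refine ⟨v, ?_⟩
    rw [← hv, hμ, AEMeasurable.map_map_of_aemeasurable (by fun_prop) hGm]
    congr 1
    ext ω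
    simp only [Function.comp_apply]
    conv_lhs => rw [pi_eq_sum_univ' fun i ↦ G i ω]
    simp [mul_comm]
  have : IsGaussian μ := isGaussian_of_map_eq_gaussianReal fun L ↦ ⟨0, hmap L⟩
  have hcentered (L : StrongDual ℝ (Fin n → ℝ)) : μ[L] = 0 := by
    obtain ⟨v, hv⟩ := hmap L
    have h := integral_id_gaussianReal (μ := 0) (v := v)
    rw [← hv, integral_map (by fun_prop) (by fun_prop)] at h
    exact h
  have hf2 : ContDiff ℝ 2 f := contDiff_infty.1 hf 2
  have hf1 : ContDiff ℝ 1 (fderiv ℝ f) := hf2.fderiv_right (by norm_num)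
  have hc0 : Continuous f := hf.continuous
  have hc2 : Continuous (fderiv ℝ (fderiv ℝ f)) := hf1.continuous_fderiv (by norm_num)
  have hD (x : Fin n → ℝ) (i j : Fin n) :
      fderiv ℝ (fun y ↦ fderiv ℝ f y (Pi.single j 1)) x (Pi.single i 1) =
        fderiv ℝ (fderiv ℝ f) x (Pi.single i 1) (Pi.single j 1) := by
    rw [fderiv_clm_apply (hf1.differentiable (by norm_num) x) (by fun_prop)]
    simp
  have main := IsGaussian.integral_sub_eq_half_sum hcentered hf2 fun m _ ↦ hgrowth m
  rw [hμ, integral_map hGm hc0.aestronglyMeasurable] at main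
  rw [main]
  congr 1
  refine Finset.sum_congr rfl fun i _ ↦ Finset.sum_congr rfl fun j _ ↦ ?_
  rw [integral_map hGm (Continuous.aestronglyMeasurable (by fun_prop))]
  congr 1
  refine intervalIntegral.integral_congr fun t _ ↦ ?_
  simp only [hD]
  rw [integral_map hGm (Continuous.aestronglyMeasurable (by fun_prop))]
  rfl
end

section
/- Let B, G_1, …, G_n be jointly Gaussian centered with E[B²] = σ², and let h: ℝⁿ → ℝ be smooth of moderate growth. Writing φ(s) = Φ(s) − 1/2 for the shifted standard normal CDF and G = (G_1,…,G_n), one has E[B·γ(B)·h(φ(G_1),…,φ(G_n))] = (1/(1+σ²))·∑_{i=1}^n E[B·G_i]·E[∂h/∂x_i(φ(G_1),…,φ(G_n))·γ(B)·γ(G_i)]. -/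
open MeasureTheory ProbabilityTheory

noncomputable def gauss (s : ℝ) : ℝ := (Real.sqrt (2 * Real.pi))⁻¹ * Real.exp (-s ^ 2 / 2)

noncomputable def PhiCDF (a : ℝ) : ℝ := ∫ t in Set.Iic a, gauss t

noncomputable def phiTr (s : ℝ) : ℝ := PhiCDF s - 1 / 2

lemma gauss_eq_gaussianPDFReal (s : ℝ) : gauss s = gaussianPDFReal 0 1 s := by
  simp [gauss, gaussianPDFReal]

lemma continuous_gauss : Continuous gauss := by
  unfold gauss
  fun_prop

lemma gauss_nonneg (s : ℝ) : 0 ≤ gauss s := by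
  unfold gauss
  positivity

lemma gauss_le_exp (s : ℝ) : gauss s ≤ Real.exp (-s ^ 2 / 2) := by
  have h : (Real.sqrt (2 * Real.pi))⁻¹ ≤ 1 := by
    apply inv_le_one_of_one_le₀
    rw [Real.one_le_sqrt]
    nlinarith [Real.pi_gt_three]
  unfold gauss
  exact mul_le_of_le_one_left (Real.exp_nonneg _) h

lemma abs_gauss_le_one (s : ℝ) : |gauss s| ≤ 1 := by
  rw [abs_of_nonneg (gauss_nonneg s)]
  refine (gauss_le_exp s).trans (Real.exp_le_one_iff.2 ?_)
  nlinarith [sq_nonneg s]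

lemma abs_mul_gauss_le_one (s : ℝ) : |s * gauss s| ≤ 1 := by
  rw [abs_mul, abs_of_nonneg (gauss_nonneg s)]
  have h1 : |s| ≤ Real.exp (s ^ 2 / 2) := by
    have := Real.add_one_le_exp (s ^ 2 / 2)
    nlinarith [sq_nonneg (|s| - 1), sq_abs s]
  calc |s| * gauss s ≤ Real.exp (s ^ 2 / 2) * Real.exp (-s ^ 2 / 2) := by
        gcongr
        · exact gauss_nonneg s
        · exact gauss_le_exp s
    _ = 1 := by rw [← Real.exp_add]; simp [neg_div]

lemma hasDerivAt_gauss (s : ℝ) : HasDerivAt gauss (-s * gauss s) s := by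
  have h1 : HasDerivAt (fun s : ℝ => -s ^ 2 / 2) (-s) s := by
    refine (((hasDerivAt_pow 2 s).neg).div_const 2).congr_deriv ?_
    simp [neg_div]
  refine ((h1.exp).const_mul (Real.sqrt (2 * Real.pi))⁻¹).congr_deriv ?_
  unfold gauss
  ring

lemma integrable_gauss : Integrable gauss := by
  rw [funext gauss_eq_gaussianPDFReal]
  exact integrable_gaussianPDFReal 0 1

lemma hasDerivAt_phiTr (s : ℝ) : HasDerivAt phiTr (gauss s) s := by
  have h1 : phiTr = fun s => (∫ t in (0 : ℝ)..s, gauss t) + (PhiCDF 0 - 1 / 2) := by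
    ext s
    rw [← intervalIntegral.integral_Iic_sub_Iic integrable_gauss.integrableOn
      integrable_gauss.integrableOn]
    simp only [phiTr, PhiCDF]
    ring
  rw [h1]
  exact (intervalIntegral.integral_hasDerivAt_right
    (integrable_gauss.intervalIntegrable) (continuous_gauss.stronglyMeasurableAtFilter _ _)
    continuous_gauss.continuousAt).add_const _

lemma continuous_phiTr : Continuous phiTr :=
  continuous_iff_continuousAt.2 fun s => (hasDerivAt_phiTr s).continuousAt

lemma phiTr_mem_Icc (s : ℝ) : phiTr s ∈ Set.Icc (-1 : ℝ) 1 := by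
  have h0 : 0 ≤ PhiCDF s := integral_nonneg fun t => gauss_nonneg t
  have h1 : PhiCDF s ≤ 1 := by
    calc PhiCDF s ≤ ∫ t, gauss t :=
          setIntegral_le_integral integrable_gauss (Filter.Eventually.of_forall gauss_nonneg)
      _ = 1 := by
          rw [funext gauss_eq_gaussianPDFReal]
          exact integral_gaussianPDFReal_eq_one 0 one_ne_zero
  unfold phiTr
  constructor <;> linarith

/-- A continuous function is bounded on the range of the coordinatewise shifted normal CDF. -/
lemma exists_abs_comp_phiTr_le {n : ℕ} {f : (Fin n → ℝ) → ℝ} (hf : Continuous f) :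
    ∃ C, ∀ x : Fin n → ℝ, |f (fun i => phiTr (x i))| ≤ C := by
  have hK : IsCompact (Set.univ.pi fun _ : Fin n => Set.Icc (-1 : ℝ) 1) :=
    isCompact_univ_pi fun _ => isCompact_Icc
  obtain ⟨C, hC⟩ := hK.exists_bound_of_continuousOn hf.continuousOn
  exact ⟨C, fun x => hC _ fun i _ => phiTr_mem_Icc (x i)⟩

lemma hasDerivAt_gaussianPDFReal_zero (v : NNReal) (s : ℝ) :
    HasDerivAt (gaussianPDFReal 0 v) (-(s / v) * gaussianPDFReal 0 v s) s := by
  have h1 : HasDerivAt (fun s : ℝ => -(s - 0) ^ 2 / (2 * v)) (-(s / v)) s := by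
    refine ((((hasDerivAt_id s).sub_const 0).pow 2).neg.div_const (2 * (v : ℝ))).congr_deriv ?_
    simp
    ring
  refine ((h1.exp).const_mul (Real.sqrt (2 * Real.pi * v))⁻¹).congr_deriv ?_
  unfold gaussianPDFReal
  ring

/-- Gaussian integration by parts in one variable, for functions weighted by `gauss`. -/
lemma integral_mul_gauss_mul_gaussianReal (v : NNReal) {f f' : ℝ → ℝ} {C C' : ℝ}
    (hf : ∀ b, HasDerivAt f (f' b) b) (hf' : Continuous f')
    (hC : ∀ b, |f b| ≤ C) (hC' : ∀ b, |f' b| ≤ C') :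
    (1 + (v : ℝ)) * ∫ b, b * gauss b * f b ∂gaussianReal 0 v =
      v * ∫ b, gauss b * f' b ∂gaussianReal 0 v := by
  by_cases hv : v = 0
  · subst hv
    simp
  have hv' : (v : ℝ) ≠ 0 := by exact_mod_cast hv
  have hfc : Continuous f := continuous_iff_continuousAt.2 fun s => (hf s).continuousAt
  have hp := integrable_gaussianPDFReal 0 v
  have hg := continuous_gauss
  have hbdd : ∀ (k u : ℝ → ℝ) (D : ℝ), Continuous k → Continuous u → (∀ b, |k b| ≤ 1) →
      (∀ b, |u b| ≤ D) → Integrable (fun b => gaussianPDFReal 0 v b * (k b * u b)) := by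
    intro k u D hk hu hk1 huD
    refine hp.mul_bdd (c := D) (hk.mul hu).aestronglyMeasurable (Filter.Eventually.of_forall fun b => ?_)
    rw [Real.norm_eq_abs, abs_mul]
    exact (mul_le_of_le_one_left (abs_nonneg _) (hk1 b)).trans (huD b)
  have i0 := hbdd gauss f C hg hfc abs_gauss_le_one hC
  have i1 := hbdd (fun b => b * gauss b) f C (by fun_prop) hfc abs_mul_gauss_le_one hC
  have i2 := hbdd gauss f' C' hg hf' abs_gauss_le_one hC'
  have hd : ∀ b, HasDerivAt (fun b => gaussianPDFReal 0 v b * (gauss b * f b))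
      (gaussianPDFReal 0 v b * (gauss b * f' b) -
        (1 + (v : ℝ)) / v * (gaussianPDFReal 0 v b * (b * gauss b * f b))) b := by
    intro b
    refine ((hasDerivAt_gaussianPDFReal_zero v b).mul
      ((hasDerivAt_gauss b).mul (hf b))).congr_deriv ?_
    simp only [Pi.mul_apply]
    field_simp
    ring
  have key := integral_eq_zero_of_hasDerivAt_of_integrable hd (i2.sub (i1.const_mul _)) i0
  rw [integral_sub i2 (i1.const_mul _), integral_const_mul] at key
  simp only [integral_gaussianReal_eq_integral_smul hv, smul_eq_mul]
  rw [sub_eq_zero.1 key]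
  field_simp

/-- A random pair all of whose linear combinations are centered Gaussian is jointly Gaussian. -/
lemma hasGaussianLaw_prodMk_of_linearCombination {Ω : Type*} [MeasureSpace Ω]
    {n : ℕ} {B : Ω → ℝ} {G : Fin n → Ω → ℝ}
    (hB : AEMeasurable B) (hG : ∀ i, AEMeasurable (G i))
    (hGauss : ∀ (c : ℝ) (d : Fin n → ℝ), ∃ v : NNReal,
      Measure.map (fun ω => c * B ω + ∑ i, d i * G i ω) ℙ = gaussianReal 0 v) :
    HasGaussianLaw (fun ω => (B ω, fun i => G i ω)) (ℙ : Measure Ω) := by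
  refine ⟨isGaussian_of_map_eq_gaussianReal fun L => ?_⟩
  obtain ⟨v, hv⟩ := hGauss (L (1, 0)) fun i => L (0, Pi.single i 1)
  refine ⟨0, v, ?_⟩
  rw [AEMeasurable.map_map_of_aemeasurable (by fun_prop)
    (hB.prodMk (aemeasurable_pi_lambda _ hG)), ← hv]
  congr 1
  ext ω
  have h1 : ((B ω, fun i => G i ω) : ℝ × (Fin n → ℝ)) =
      B ω • (1, 0) + ∑ i, G i ω • (0, Pi.single i 1) := by
    ext j
    · simp [Prod.fst_sum]
    · simp [Prod.snd_sum, Finset.sum_apply, Pi.single_apply]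
  simp only [Function.comp_apply, h1, map_add, map_sum, map_smul, smul_eq_mul, mul_comm]

/-- Subtracting from `G` its regression on `B` leaves a vector independent of `B`. -/
lemma indepFun_sub_regression {Ω : Type*} [MeasureSpace Ω]
    {n : ℕ} {B : Ω → ℝ} {G : Fin n → Ω → ℝ}
    (hBG : HasGaussianLaw (fun ω => (B ω, fun i => G i ω)) (ℙ : Measure Ω))
    (c : Fin n → ℝ) (hc : ∀ i, cov[B, G i] = c i * cov[B, B]) :
    IndepFun B (fun ω i => G i ω - c i * B ω) (ℙ : Measure Ω) := by
  have hBm : MemLp B 2 (ℙ : Measure Ω) := hBG.fst.memLp_two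
  have hGm : ∀ i, MemLp (G i) 2 (ℙ : Measure Ω) := fun i => (hBG.snd.eval i).memLp_two
  have := hBG.isProbabilityMeasure
  let T : ℝ × (Fin n → ℝ) →L[ℝ] ℝ × (Fin n → ℝ) :=
    (ContinuousLinearMap.fst ℝ ℝ (Fin n → ℝ)).prod
      (ContinuousLinearMap.snd ℝ ℝ (Fin n → ℝ) -
        (ContinuousLinearMap.fst ℝ ℝ (Fin n → ℝ)).smulRight c)
  have hT : HasGaussianLaw (fun ω => (B ω, fun i => G i ω - c i * B ω)) (ℙ : Measure Ω) := by
    have h : (fun ω => (B ω, fun i => G i ω - c i * B ω)) = fun ω => T (B ω, fun i => G i ω) := by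
      ext ω i <;> simp [T, mul_comm]
    rw [h]
    exact hBG.map_fun T
  refine hT.indepFun_of_covariance_strongDual fun L₁ L₂ => ?_
  have h1 : L₁ ∘ B = fun ω => L₁ 1 * B ω := by
    ext ω
    have := L₁.map_smul (B ω) 1
    simpa [mul_comm] using this
  have h2 : L₂ ∘ (fun ω i => G i ω - c i * B ω) =
      fun ω => ∑ i, L₂ (Pi.single i 1) * (G i ω - c i * B ω) := by
    ext ω
    simp only [Function.comp_apply]
    conv_lhs => rw [pi_eq_sum_univ' fun i => G i ω - c i * B ω]
    simp [mul_comm]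
  have hY : ∀ i, MemLp (fun ω => L₂ (Pi.single i 1) * (G i ω - c i * B ω)) 2 :=
    fun i => ((hGm i).sub (hBm.const_mul _)).const_mul _
  rw [h1, h2, covariance_const_mul_left, covariance_fun_sum_right hY hBm, Finset.sum_eq_zero, mul_zero]
  intro i _
  rw [covariance_const_mul_right, covariance_fun_sub_right hBm (hGm i) (hBm.const_mul _),
    covariance_const_mul_right, hc i, sub_self, mul_zero]

/-- The regression coefficient of `X` on `B` recovers their covariance, even if `B` is degenerate. -/
lemma covariance_eq_div_mul_self {Ω : Type*} [MeasureSpace Ω]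
    [IsProbabilityMeasure (ℙ : Measure Ω)] {B X : Ω → ℝ} (hB : MemLp B 2) :
    cov[B, X] = cov[B, X] / cov[B, B] * cov[B, B] := by
  by_cases h : cov[B, B] = 0
  · have h1 : B =ᵐ[ℙ] fun _ => ∫ ω, B ω := by
      rw [covariance_self hB.1.aemeasurable] at h
      exact ae_eq_integral_of_variance_eq_zero hB h
    rw [h, mul_zero, covariance]
    refine integral_eq_zero_of_ae ?_
    filter_upwards [h1] with ω hω
    simp [hω]
  · field_simp

lemma integrable_comp_of_continuous_of_bounded {Ω E : Type*} [MeasureSpace Ω]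
    [IsProbabilityMeasure (ℙ : Measure Ω)] [TopologicalSpace E] [MeasurableSpace E]
    [OpensMeasurableSpace E] {Z : Ω → E} (hZ : AEMeasurable Z) {f : E → ℝ} (hf : Continuous f)
    {C : ℝ} (hC : ∀ z, |f z| ≤ C) : Integrable fun ω => f (Z ω) :=
  Integrable.of_bound (hf.measurable.comp_aemeasurable hZ).aestronglyMeasurable C
    (Filter.Eventually.of_forall fun ω => hC (Z ω))

/-- Disintegration of `(B, G)` along the part of `G` independent of `B`. -/
lemma integral_comp_eq_integral_integral {Ω : Type*} [MeasureSpace Ω]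
    [IsProbabilityMeasure (ℙ : Measure Ω)] {n : ℕ} {B : Ω → ℝ} {G : Fin n → Ω → ℝ}
    (hB : AEMeasurable B) (hG : ∀ i, AEMeasurable (G i)) (c : Fin n → ℝ)
    (hind : IndepFun B (fun ω i => G i ω - c i * B ω) (ℙ : Measure Ω))
    {f : ℝ × (Fin n → ℝ) → ℝ} (hf : Continuous f) {C : ℝ} (hC : ∀ z, |f z| ≤ C) :
    ∫ ω, f (B ω, fun i => G i ω) =
      ∫ y, ∫ b, f (b, fun i => y i + c i * b) ∂(Measure.map B ℙ)
        ∂(Measure.map (fun ω i => G i ω - c i * B ω) ℙ) := by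
  have hY : AEMeasurable (fun ω i => G i ω - c i * B ω) (ℙ : Measure Ω) :=
    aemeasurable_pi_lambda _ fun i => (hG i).sub (hB.const_mul _)
  have := Measure.isProbabilityMeasure_map (μ := (ℙ : Measure Ω)) hB
  have := Measure.isProbabilityMeasure_map (μ := (ℙ : Measure Ω)) hY
  have hf' : Continuous fun p : ℝ × (Fin n → ℝ) => f (p.1, fun i => p.2 i + c i * p.1) := by
    fun_prop
  have hint : Integrable (fun p : ℝ × (Fin n → ℝ) => f (p.1, fun i => p.2 i + c i * p.1))
      ((Measure.map B ℙ).prod (Measure.map (fun ω i => G i ω - c i * B ω) ℙ)) :=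
    Integrable.of_bound hf'.aestronglyMeasurable C (Filter.Eventually.of_forall fun p => hC _)
  rw [← integral_prod_symm _ hint, ← (indepFun_iff_map_prod_eq_prod_map_map hB hY).1 hind,
    integral_map (hB.prodMk hY) hf'.aestronglyMeasurable]
  simp

/-- Chain rule for `h ∘ φ` along an affine line. -/
lemma hasDerivAt_comp_phiTr {n : ℕ} {h : (Fin n → ℝ) → ℝ} (hh : Differentiable ℝ h)
    (y c : Fin n → ℝ) (b : ℝ) :
    HasDerivAt (fun b => h fun i => phiTr (y i + c i * b))
      (∑ i, c i * (fderiv ℝ h (fun j => phiTr (y j + c j * b)) (Pi.single i 1) *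
        gauss (y i + c i * b))) b := by
  have h1 : HasDerivAt (fun b => fun i => phiTr (y i + c i * b))
      (fun i => gauss (y i + c i * b) * c i) b := by
    refine hasDerivAt_pi.2 fun i => (hasDerivAt_phiTr _).comp b ?_
    simpa using ((hasDerivAt_id b).const_mul (c i)).const_add (y i)
  refine ((hh _).hasFDerivAt.comp_hasDerivAt b h1).congr_deriv ?_
  conv_lhs => rw [pi_eq_sum_univ' fun i => gauss (y i + c i * b) * c i]
  simp only [map_sum, map_smul, smul_eq_mul]
  exact Finset.sum_congr rfl fun i _ => by ring

theorem stmt11 {Ω : Type*} [MeasureSpace Ω] [IsProbabilityMeasure (ℙ : Measure Ω)]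
    {n : ℕ} (B : Ω → ℝ) (G : Fin n → Ω → ℝ) (σ : ℝ)
    (hGauss : ∀ (c : ℝ) (d : Fin n → ℝ), ∃ v : NNReal,
      Measure.map (fun ω => c * B ω + ∑ i, d i * G i ω) ℙ = gaussianReal 0 v)
    (hvar : (∫ ω, (B ω) ^ 2) = σ ^ 2)
    (h : (Fin n → ℝ) → ℝ) (hh : ContDiff ℝ (⊤ : ℕ∞) h)
    (hgrowth : ∀ (m : ℕ) (a : ℝ), 0 < a →
      Filter.Tendsto (fun x : Fin n → ℝ => ‖iteratedFDeriv ℝ m h x‖ * Real.exp (-a * ‖x‖ ^ 2))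
        (Filter.cocompact _) (nhds 0)) :
    ∫ ω, B ω * gauss (B ω) * h (fun i => phiTr (G i ω)) =
      (1 / (1 + σ ^ 2)) * ∑ i, (∫ ω, B ω * G i ω) *
        ∫ ω, fderiv ℝ h (fun j => phiTr (G j ω)) (Pi.single i 1) * gauss (B ω) * gauss (G i ω) := by
  have hprob : ∀ v, IsProbabilityMeasure (gaussianReal 0 v) := fun v => inferInstance
  have hmeas : ∀ (c : ℝ) (d : Fin n → ℝ), AEMeasurable fun ω => c * B ω + ∑ i, d i * G i ω := by
    intro c d
    obtain ⟨v, hv⟩ := hGauss c d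
    exact AEMeasurable.of_map_ne_zero (hv ▸ (hprob v).ne_zero)
  have hB : AEMeasurable B := by simpa using hmeas 1 0
  have hG : ∀ i, AEMeasurable (G i) := fun i => by
    simpa [Pi.single_apply] using hmeas 0 (Pi.single i 1)
  have hBG := hasGaussianLaw_prodMk_of_linearCombination hB hG hGauss
  have hB2 : MemLp B 2 := hBG.fst.memLp_two
  obtain ⟨v, hv⟩ := hGauss 1 0
  simp only [one_mul, Pi.zero_apply, zero_mul, Finset.sum_const_zero, add_zero] at hv
  have hlaw : HasLaw B (gaussianReal 0 v) ℙ := ⟨hB, hv⟩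
  have hmean : ∫ ω, B ω = 0 := by
    rw [hlaw.integral_eq]
    exact integral_id_gaussianReal
  have hcov : ∀ X : Ω → ℝ, MemLp X 2 → cov[B, X] = ∫ ω, B ω * X ω := fun X hX => by
    rw [covariance_eq_sub hB2 hX, hmean, zero_mul, sub_zero]
    rfl
  have hBB : cov[B, B] = (v : ℝ) := by
    rw [covariance_self hB, hlaw.variance_eq]
    exact variance_fun_id_gaussianReal
  have hσ : (v : ℝ) = σ ^ 2 := by
    rw [← hvar, ← hBB, hcov B hB2]
    simp only [sq]
  obtain ⟨c, hc⟩ : ∃ c : Fin n → ℝ, ∀ i, cov[B, G i] = c i * cov[B, B] :=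
    ⟨_, fun i => covariance_eq_div_mul_self hB2⟩
  have hcv : ∀ i, ∫ ω, B ω * G i ω = c i * v := fun i => by
    rw [← hcov (G i) (hBG.snd.eval i).memLp_two, hc, hBB]
  have hind := indepFun_sub_regression hBG c hc
  have hD : ∀ i, Continuous fun x => fderiv ℝ h x (Pi.single i 1) := fun i =>
    (hh.continuous_fderiv (by simp)).clm_apply continuous_const
  obtain ⟨C, hC⟩ := exists_abs_comp_phiTr_le hh.continuous
  choose K hK using fun i => exists_abs_comp_phiTr_le (hD i)
  have hφ := continuous_phiTr
  have hγ := continuous_gauss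
  have hDφ : ∀ i, Continuous fun x : Fin n → ℝ =>
      fderiv ℝ h (fun j => phiTr (x j)) (Pi.single i 1) * gauss (x i) := fun i =>
    ((hD i).comp (by fun_prop : Continuous fun (x : Fin n → ℝ) j => phiTr (x j))).mul
      (by fun_prop)
  have hhφ : Continuous fun x : Fin n → ℝ => h fun j => phiTr (x j) :=
    hh.continuous.comp (by fun_prop)
  have hDK : ∀ i (x : Fin n → ℝ),
      |fderiv ℝ h (fun j => phiTr (x j)) (Pi.single i 1) * gauss (x i)| ≤ K i := fun i x => by
    rw [abs_mul]
    exact (mul_le_of_le_one_right (abs_nonneg _) (abs_gauss_le_one _)).trans (hK i x)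
  have hSK : ∀ x : Fin n → ℝ,
      |∑ i, c i * (fderiv ℝ h (fun j => phiTr (x j)) (Pi.single i 1) * gauss (x i))| ≤
        ∑ i, |c i| * K i := fun x => by
    refine (Finset.abs_sum_le_sum_abs _ _).trans (Finset.sum_le_sum fun i _ => ?_)
    rw [abs_mul]
    exact mul_le_mul_of_nonneg_left (hDK i x) (abs_nonneg _)
  have hSc : Continuous fun x : Fin n → ℝ =>
      ∑ i, c i * (fderiv ℝ h (fun j => phiTr (x j)) (Pi.single i 1) * gauss (x i)) :=
    continuous_finsetSum _ fun i _ => (hDφ i).const_mul _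
  have key : (1 + (v : ℝ)) * ∫ ω, B ω * gauss (B ω) * h (fun i => phiTr (G i ω)) =
      v * ∫ ω, gauss (B ω) * ∑ i, c i *
        (fderiv ℝ h (fun j => phiTr (G j ω)) (Pi.single i 1) * gauss (G i ω)) := by
    have e1 := integral_comp_eq_integral_integral hB hG c hind
      (f := fun p => p.1 * gauss p.1 * h fun i => phiTr (p.2 i)) (C := C)
      ((by fun_prop : Continuous fun p : ℝ × (Fin n → ℝ) => p.1 * gauss p.1).mul
        (hhφ.comp continuous_snd)) fun p => by
        rw [abs_mul]
        exact (mul_le_of_le_one_left (abs_nonneg _) (abs_mul_gauss_le_one _)).trans (hC p.2)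
    have e2 := integral_comp_eq_integral_integral hB hG c hind
      (f := fun p => gauss p.1 * ∑ i, c i *
        (fderiv ℝ h (fun j => phiTr (p.2 j)) (Pi.single i 1) * gauss (p.2 i)))
      (C := ∑ i, |c i| * K i)
      ((by fun_prop : Continuous fun p : ℝ × (Fin n → ℝ) => gauss p.1).mul
        (hSc.comp continuous_snd)) fun p => by
        rw [abs_mul]
        exact (mul_le_of_le_one_left (abs_nonneg _) (abs_gauss_le_one _)).trans (hSK p.2)
    rw [e1, e2, ← integral_const_mul, ← integral_const_mul, hv]
    refine integral_congr_ae (Filter.Eventually.of_forall fun y => ?_)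
    exact integral_mul_gauss_mul_gaussianReal v
      (fun b => hasDerivAt_comp_phiTr (hh.differentiable (by simp)) y c b)
      (hSc.comp (by fun_prop : Continuous fun (b : ℝ) i => y i + c i * b))
      (fun b => hC fun i => y i + c i * b) (fun b => hSK fun i => y i + c i * b)
  have hZ : AEMeasurable (fun ω => (B ω, fun i => G i ω)) (ℙ : Measure Ω) :=
    hB.prodMk (aemeasurable_pi_lambda _ hG)
  have hint : ∀ i, Integrable fun ω =>
      fderiv ℝ h (fun j => phiTr (G j ω)) (Pi.single i 1) * gauss (B ω) * gauss (G i ω) := by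
    intro i
    have := integrable_comp_of_continuous_of_bounded hZ
      (f := fun p => gauss p.1 *
        (fderiv ℝ h (fun j => phiTr (p.2 j)) (Pi.single i 1) * gauss (p.2 i))) (C := K i)
      ((hγ.comp continuous_fst).mul ((hDφ i).comp continuous_snd)) fun p => by
        rw [abs_mul]
        exact (mul_le_of_le_one_left (abs_nonneg _) (abs_gauss_le_one _)).trans (hDK i p.2)
    refine this.congr (Filter.Eventually.of_forall fun ω => ?_)
    ring
  have hsum : ∫ ω, gauss (B ω) * ∑ i, c i *
        (fderiv ℝ h (fun j => phiTr (G j ω)) (Pi.single i 1) * gauss (G i ω)) =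
      ∑ i, c i * ∫ ω,
        fderiv ℝ h (fun j => phiTr (G j ω)) (Pi.single i 1) * gauss (B ω) * gauss (G i ω) := by
    simp only [← integral_const_mul]
    rw [← integral_finsetSum _ fun i _ => (hint i).const_mul (c i)]
    refine integral_congr_ae (Filter.Eventually.of_forall fun ω => ?_)
    simp only [Finset.mul_sum]
    exact Finset.sum_congr rfl fun i _ => by ring
  have hpos : (1 + (v : ℝ)) ≠ 0 := by positivity
  rw [← hσ, one_div, eq_inv_mul_iff_mul_eq₀ hpos, key, hsum, Finset.mul_sum]
  exact Finset.sum_congr rfl fun i _ => by rw [hcv i]; ring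
end
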